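/- arXiv:1709.01146 — 4 statements merged into one kernel-verified Lean document; each statement's English description precedes it below -/
import Mathlib

section
/- For every n ≥ 0 and every t : ℕ with L n t ≥ 2 (equivalently t ≥ x (n+1)), the counting functions of consecutive stages of the model sieve satisfy the exact recursion L (n+1) t = L n t − 1 − ⌊(L n t − 2) / x (n+1)⌋, expressing that stage n+1 removes exactly 1 + ⌊(L n t − 2)/x (n+1)⌋ of the L n t survivors ≤ t. -/
/-- `gx x` is the 0-indexed strictly increasing enumeration of `{k : ℕ | k % x ≠ 1}`. -/
noncomputable def gx (x : ℕ) : ℕ → ℕ := Nat.nth (fun k => k % x ≠ 1)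

/-- `modelF n` is the 0-indexed strictly increasing enumeration of the integers surviving
`n` stages of the model sieve:  `modelF 0 k = k + 1` and
`modelF (n+1) k = modelF n (gx (modelX (n+1)) k)` where `modelX (n+1) = modelF n 1`. -/
noncomputable def modelF : ℕ → ℕ → ℕ
  | 0, k => k + 1
  | n + 1, k => modelF n (gx (modelF n 1) k)

/-- `modelX n` is the `n`-th model prime (`modelX 1 = 2, modelX 2 = 3, modelX 3 = 5, ...`). -/
noncomputable def modelX (n : ℕ) : ℕ := modelF (n - 1) 1

/-- `Lcount n t` is the number of survivors of the first `n` stages of the model sieve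
that are `≤ t`. -/
noncomputable def Lcount (n t : ℕ) : ℕ := Set.ncard {k : ℕ | modelF n k ≤ t}

theorem infinite_setOf_mod_ne_one {x : ℕ} (hx : 2 ≤ x) : {k : ℕ | k % x ≠ 1}.Infinite := by
  refine Set.infinite_of_injective_forall_mem (f := fun k : ℕ => x * k)
    (fun a b hab => Nat.eq_of_mul_eq_mul_left (by omega) hab) fun k => ?_
  simp

theorem gx_strictMono {x : ℕ} (hx : 2 ≤ x) : StrictMono (gx x) :=
  Nat.nth_strictMono (infinite_setOf_mod_ne_one hx)

theorem gx_zero {x : ℕ} : gx x 0 = 0 :=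
  Nat.nth_zero_of_zero (by simp)

theorem modelF_strictMono_and_zero (n : ℕ) : StrictMono (modelF n) ∧ modelF n 0 = 1 := by
  induction n with
  | zero => exact ⟨fun a b hab => by simpa [modelF] using hab, rfl⟩
  | succ n ih =>
    have hx : 2 ≤ modelF n 1 := by
      have := ih.1 Nat.zero_lt_one
      omega
    refine ⟨fun a b hab => ih.1 (gx_strictMono hx hab), ?_⟩
    change modelF n (gx (modelF n 1) 0) = 1
    rw [gx_zero, ih.2]

theorem two_le_modelF_one (n : ℕ) : 2 ≤ modelF n 1 := by
  obtain ⟨hmono, hzero⟩ := modelF_strictMono_and_zero n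
  have := hmono Nat.zero_lt_one
  omega

theorem StrictMono.le_iff_lt_ncard {f : ℕ → ℕ} (hf : StrictMono f) (t k : ℕ) :
    f k ≤ t ↔ k < {j : ℕ | f j ≤ t}.ncard := by
  have hex : ∃ j, t < f j := ⟨t + 1, hf.le_apply⟩
  have hset : {j : ℕ | f j ≤ t} = Set.Iio (Nat.find hex) := by
    ext j
    refine ⟨fun hj => ?_, fun hj => not_lt.mp (Nat.find_min hex hj)⟩
    exact hf.lt_iff_lt.mp (lt_of_le_of_lt hj (Nat.find_spec hex))
  have hcard : {j : ℕ | f j ≤ t}.ncard = Nat.find hex := by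
    rw [hset, ← Finset.coe_Iio, Set.ncard_coe_finset, Nat.card_Iio]
  rw [hcard]
  exact Set.ext_iff.mp hset k

theorem count_mod_ne_one {x : ℕ} (hx : 2 ≤ x) (m : ℕ) :
    Nat.count (fun k => k % x ≠ 1) (m + 2) = m + 1 - m / x := by
  induction m with
  | zero => simp [Nat.count_succ, Nat.mod_eq_of_lt hx]
  | succ m ih =>
    have hiff : (m + 2) % x = 1 ↔ x ∣ m + 1 := by
      rw [← Nat.modEq_zero_iff_dvd]
      have hone : (m + 2) % x = 1 ↔ m + 1 + 1 ≡ 0 + 1 [MOD x] := by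
        rw [Nat.ModEq, Nat.mod_eq_of_lt (by omega : 0 + 1 < x)]
      rw [hone]
      exact ⟨Nat.ModEq.add_right_cancel' 1, Nat.ModEq.add_right 1⟩
    have hle := Nat.div_le_self m x
    rw [Nat.count_succ, ih, Nat.succ_div]
    by_cases hd : x ∣ m + 1
    · simp [hiff, hd]
    · simp only [ne_eq, hiff, hd, not_false_eq_true, if_true, if_false]
      omega

theorem Lcount_succ (n t : ℕ) :
    Lcount (n + 1) t = Nat.count (fun k => k % modelF n 1 ≠ 1) (Lcount n t) := by
  have hset : {k : ℕ | modelF (n + 1) k ≤ t} =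
      Set.Iio (Nat.count (fun k => k % modelF n 1 ≠ 1) (Lcount n t)) := by
    ext k
    change modelF n (gx (modelF n 1) k) ≤ t ↔ k < _
    rw [(modelF_strictMono_and_zero n).1.le_iff_lt_ncard, ← not_le, ← not_le,
      Nat.count_le_iff_le_nth (infinite_setOf_mod_ne_one (two_le_modelF_one n))]
    rfl
  rw [Lcount, hset, ← Finset.coe_Iio, Set.ncard_coe_finset, Nat.card_Iio]

/-- Exact recursion for the counting function of the model sieve: if `L n t ≥ 2` then
stage `n+1` removes exactly `1 + ⌊(L n t - 2)/(x (n+1))⌋` of the `L n t` survivors `≤ t`. -/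
theorem model_sieve_count_recursion (n t : ℕ) (h : 2 ≤ Lcount n t) :
    Lcount (n + 1) t = Lcount n t - 1 - (Lcount n t - 2) / modelX (n + 1) := by
  obtain ⟨m, hm⟩ := Nat.exists_eq_add_of_le' h
  rw [Lcount_succ, hm, count_mod_ne_one (two_le_modelF_one n)]
  rfl
end

section
/- Prime number theorem for the model sieve: the n-th model prime satisfies x n / (n · log n) → 1 as n → ∞, i.e., x n is asymptotic to n log n. -/
section Enumeration

lemma count_mod_ne_one_add {x : ℕ} (hx : 2 ≤ x) (b : ℕ) :
    Nat.count (fun k => k % x ≠ 1) b + (b / x + if 1 < b % x then 1 else 0) = b := by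
  have h := Nat.count_modEq_card b (show 0 < x by omega) 1
  rw [Nat.mod_eq_of_lt (show 1 < x by omega)] at h
  rw [← h]
  clear h
  induction b with
  | zero => simp
  | succ b ih =>
    rw [Nat.count_succ, Nat.count_succ]
    have h1 : b ≡ 1 [MOD x] ↔ b % x = 1 := by
      rw [Nat.ModEq, Nat.mod_eq_of_lt (show 1 < x by omega)]
    simp only [h1, ne_eq] at ih ⊢
    by_cases hb : b % x = 1 <;> simp only [hb, not_true, not_false_eq_true, if_true, if_false] <;>
      omega

lemma setOf_mod_ne_one_infinite {x : ℕ} (hx : 2 ≤ x) :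
    (Set.ofPred fun k : ℕ => k % x ≠ 1).Infinite := by
  refine Set.infinite_of_injective_forall_mem (f := fun k : ℕ => x * k) ?_ ?_
  · intro a b h
    exact Nat.eq_of_mul_eq_mul_left (by omega) h
  · intro k
    change x * k % x ≠ 1
    simp

lemma self_le_gx {x : ℕ} (hx : 2 ≤ x) (k : ℕ) : k ≤ gx x k :=
  (Nat.nth_strictMono (setOf_mod_ne_one_infinite hx)).le_apply

lemma gx_mod_ne_one {x : ℕ} (hx : 2 ≤ x) (k : ℕ) : gx x k % x ≠ 1 :=
  Nat.nth_mem_of_infinite (setOf_mod_ne_one_infinite hx) k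

lemma gx_eq_add {x : ℕ} (hx : 2 ≤ x) (k : ℕ) :
    gx x k = k + (gx x k / x + if 1 < gx x k % x then 1 else 0) := by
  have h := count_mod_ne_one_add hx (gx x k)
  rw [gx, Nat.count_nth_of_infinite (setOf_mod_ne_one_infinite hx)] at h
  exact h.symm

lemma succ_le_gx {x k : ℕ} (hx : 2 ≤ x) (hk : 1 ≤ k) : k + 1 ≤ gx x k := by
  have h := gx_eq_add hx k
  have hmod := gx_mod_ne_one hx k
  have hdiv := Nat.div_add_mod (gx x k) x
  rcases Nat.eq_zero_or_pos (gx x k / x) with h0 | h0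
  · rw [h0] at hdiv h
    split_ifs at h <;> omega
  · omega

lemma gx_bounds {x : ℕ} (hx : 2 ≤ x) (k : ℕ) :
    (x : ℝ) / (x - 1) * k ≤ gx x k ∧ (gx x k : ℝ) ≤ x / (x - 1) * k + 1 := by
  have h := gx_eq_add hx k
  have hmod := gx_mod_ne_one hx k
  have hlt := Nat.mod_lt (gx x k) (show 0 < x by omega)
  have hdiv := Nat.div_add_mod (gx x k) x
  set a := gx x k
  set q := a / x
  set r := a % x
  have hx' : (2 : ℝ) ≤ x := by exact_mod_cast hx
  have hx1 : (0 : ℝ) < x - 1 := by linarith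
  have hdiv' : (x : ℝ) * q + r = a := by exact_mod_cast hdiv
  have hlt' : (r : ℝ) + 1 ≤ x := by exact_mod_cast hlt
  rw [div_mul_eq_mul_div]
  constructor
  · rw [div_le_iff₀ hx1]
    split_ifs at h with hr
    · have h' : (a : ℝ) = k + (q + 1) := by exact_mod_cast h
      nlinarith
    · have hr0 : r = 0 := by omega
      have h' : (a : ℝ) = k + q := by exact_mod_cast h
      rw [hr0] at hdiv'
      push_cast at hdiv'
      nlinarith
  · rw [← sub_le_iff_le_add, le_div_iff₀ hx1]
    split_ifs at h with hr
    · have h' : (a : ℝ) = k + (q + 1) := by exact_mod_cast h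
      have hr' : (1 : ℝ) ≤ r := by exact_mod_cast hr.le
      nlinarith
    · have hr0 : r = 0 := by omega
      have h' : (a : ℝ) = k + q := by exact_mod_cast h
      rw [hr0] at hdiv'
      push_cast at hdiv'
      nlinarith

end Enumeration

section Sieve

lemma succ_le_modelF (n k : ℕ) : k + 1 ≤ modelF n k := by
  induction n generalizing k with
  | zero => simp [modelF]
  | succ n ih =>
    rw [modelF]
    exact (Nat.succ_le_succ (self_le_gx (ih 1) k)).trans (ih _)

/-- The reciprocal of the density of the integers surviving `n` stages of the model sieve. -/
noncomputable def modelProd (n : ℕ) : ℝ :=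
  ∏ i ∈ Finset.range n, (modelF i 1 : ℝ) / (modelF i 1 - 1)

lemma modelProd_succ (n : ℕ) :
    modelProd (n + 1) = modelProd n * ((modelF n 1 : ℝ) / (modelF n 1 - 1)) :=
  Finset.prod_range_succ _ _

lemma one_le_modelF_sub_one (n : ℕ) : (1 : ℝ) ≤ modelF n 1 - 1 := by
  have h : ((1 + 1 : ℕ) : ℝ) ≤ modelF n 1 := Nat.cast_le.2 (succ_le_modelF n 1)
  push_cast at h
  linarith

lemma modelProd_pos (n : ℕ) : 0 < modelProd n :=
  Finset.prod_pos fun i _ => by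
    have := one_le_modelF_sub_one i
    exact div_pos (by linarith) (by linarith)

lemma modelProd_succ_sub (n : ℕ) :
    modelProd (n + 1) - modelProd n = modelProd n / (modelF n 1 - 1) := by
  have h := one_le_modelF_sub_one n
  have h' : (modelF n 1 : ℝ) - 1 ≠ 0 := by linarith
  rw [modelProd_succ]
  field_simp
  ring

lemma modelProd_monotone : Monotone modelProd :=
  monotone_nat_of_le_succ fun n => by
    have h := one_le_modelF_sub_one n
    rw [← sub_nonneg, modelProd_succ_sub]
    exact div_nonneg (modelProd_pos n).le (by linarith)

lemma modelProd_mul_le (n k : ℕ) : modelProd n * k ≤ modelF n k - 1 := by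
  induction n generalizing k with
  | zero => simp [modelProd, modelF]
  | succ n ih =>
    rw [modelF, modelProd_succ, mul_assoc]
    exact (mul_le_mul_of_nonneg_left (gx_bounds (succ_le_modelF n 1) k).1
      (modelProd_pos n).le).trans (ih _)

lemma modelF_sub_one_le (n k : ℕ) :
    (modelF n k : ℝ) - 1 ≤ modelProd n * k + ∑ j ∈ Finset.range n, modelProd j := by
  induction n generalizing k with
  | zero => simp [modelProd, modelF]
  | succ n ih =>
    rw [modelF, modelProd_succ, mul_assoc, Finset.sum_range_succ]
    have h := mul_le_mul_of_nonneg_left (gx_bounds (succ_le_modelF n 1) k).2 (modelProd_pos n).le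
    linarith [ih (gx (modelF n 1) k)]

lemma modelProd_mul_add_le (m d k : ℕ) (hk : 1 ≤ k) :
    modelProd m * (k + d) ≤ modelF (m + d) k - 1 := by
  induction d generalizing k with
  | zero => simpa using modelProd_mul_le m k
  | succ d ih =>
    have hg : k + 1 ≤ gx (modelF (m + d) 1) k := succ_le_gx (succ_le_modelF _ 1) hk
    have hg' : (k : ℝ) + 1 ≤ gx (modelF (m + d) 1) k := by exact_mod_cast hg
    rw [← add_assoc, modelF]
    refine le_trans (mul_le_mul_of_nonneg_left ?_ (modelProd_pos m).le) (ih _ (by omega))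
    push_cast
    linarith

lemma modelProd_mul_sub_le {m n : ℕ} (h : m ≤ n) :
    modelProd m * (n + 1 - m) ≤ modelF n 1 - 1 := by
  obtain ⟨d, rfl⟩ := Nat.exists_eq_add_of_le h
  have h1 := modelProd_mul_add_le m d 1 le_rfl
  push_cast at h1 ⊢
  convert h1 using 2
  ring

lemma modelF_one_sub_one_le (n : ℕ) : (modelF n 1 : ℝ) - 1 ≤ (n + 1) * modelProd n := by
  have h := modelF_sub_one_le n 1
  have h2 : ∑ j ∈ Finset.range n, modelProd j ≤ ∑ _j ∈ Finset.range n, modelProd n :=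
    Finset.sum_le_sum fun j hj => modelProd_monotone (Finset.mem_range.1 hj).le
  rw [Finset.sum_const, Finset.card_range, nsmul_eq_mul] at h2
  push_cast at h
  linarith

lemma harmonic_le_modelProd (n : ℕ) : (harmonic n : ℝ) ≤ modelProd n := by
  induction n with
  | zero => simpa using (modelProd_pos 0).le
  | succ n ih =>
    have h := modelF_one_sub_one_le n
    have h1 := one_le_modelF_sub_one n
    have h2 : ((n : ℝ) + 1)⁻¹ ≤ modelProd n / (modelF n 1 - 1) := by
      rw [inv_eq_one_div, div_le_div_iff₀ (by positivity) (by linarith)]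
      linarith
    have h3 := modelProd_succ_sub n
    rw [harmonic_succ]
    push_cast
    linarith

open Filter Topology

lemma tendsto_log_succ_atTop : Tendsto (fun n : ℕ => Real.log (n + 1)) atTop atTop :=
  Real.tendsto_log_atTop.comp (tendsto_atTop_add_const_right _ _ tendsto_natCast_atTop_atTop)

lemma tendsto_harmonic_atTop : Tendsto (fun n : ℕ => (harmonic n : ℝ)) atTop atTop := by
  refine tendsto_atTop_mono (fun n => ?_) tendsto_log_succ_atTop
  exact_mod_cast log_add_one_le_harmonic n

lemma tendsto_modelProd_atTop : Tendsto modelProd atTop atTop :=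
  tendsto_atTop_mono harmonic_le_modelProd tendsto_harmonic_atTop

/-- Slow variation of `modelProd`, in terms of a lower bound for the later model primes. -/
lemma modelProd_add_mul_le {m : ℕ} {Y : ℝ} (hY : 0 < Y)
    (h : ∀ j, m ≤ j → Y ≤ modelF j 1 - 1) (d : ℕ) :
    modelProd (m + d) * (1 - d / Y) ≤ modelProd m := by
  induction d with
  | zero => simp
  | succ d ih =>
    refine le_trans ?_ ih
    set Z : ℝ := modelF (m + d) 1 - 1 with hZ
    have hYZ : Y ≤ Z := h (m + d) (by omega)
    have hZ0 : 0 < Z := hY.trans_le hYZ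
    have hP := modelProd_pos (m + d)
    have hsub : modelProd (m + d + 1) = modelProd (m + d) + modelProd (m + d) / Z := by
      linarith [modelProd_succ_sub (m + d)]
    have hdiv : modelProd (m + d) / Z ≤ modelProd (m + d + 1) / Y := by
      rw [hsub]
      exact div_le_div₀ (by positivity) (le_add_of_nonneg_right (by positivity)) hY hYZ
    have hnn : 0 ≤ modelProd (m + d) / Z * (d / Y) := by positivity
    rw [← add_assoc]
    push_cast
    calc modelProd (m + d + 1) * (1 - (d + 1) / Y)
        = modelProd (m + d + 1) * (1 - d / Y) - modelProd (m + d + 1) / Y := by ring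
      _ ≤ modelProd (m + d) * (1 - d / Y) := by
        rw [hsub] at hdiv ⊢
        linarith

lemma eventually_le_modelF_one_sub_one {K : ℕ} (hK : 1 ≤ K) :
    ∀ᶠ n : ℕ in atTop,
      (1 - 1 / (K : ℝ)) ^ 2 * ((n + 1) * modelProd n) ≤ modelF n 1 - 1 := by
  have hK0 : (0 : ℝ) < K := by exact_mod_cast hK
  have hdiv : Tendsto (fun n : ℕ => n / (2 * K)) atTop atTop :=
    Nat.tendsto_div_const_atTop (by omega)
  filter_upwards [hdiv.eventually_ge_atTop 1,
    (tendsto_modelProd_atTop.comp hdiv).eventually_ge_atTop (4 * (K : ℝ) * K)] with n hi hP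
  simp only [Function.comp_apply] at hP
  set i := n / (2 * K)
  have hlow : 2 * K * i ≤ n := Nat.mul_div_le n (2 * K)
  have hhigh : n < 2 * K * (i + 1) := Nat.lt_mul_div_succ n (by omega)
  have hmn : 2 * i ≤ n := by nlinarith
  have hi' : (1 : ℝ) ≤ i := by exact_mod_cast hi
  have hlow' : 2 * (K : ℝ) * i ≤ n := by exact_mod_cast hlow
  have hhigh' : (n : ℝ) ≤ 2 * K * (i + 1) := by exact_mod_cast hhigh.le
  have hPi := modelProd_pos i
  have hY : 0 < i * modelProd i := by positivity
  have hslow := modelProd_add_mul_le hY (m := 2 * i) (fun j hj => by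
    refine le_trans ?_ (modelProd_mul_sub_le (show i ≤ j by omega))
    rw [mul_comm]
    have hj' : 2 * (i : ℝ) ≤ j := by exact_mod_cast hj
    exact mul_le_mul_of_nonneg_left (by linarith) hPi.le) (n - 2 * i)
  rw [Nat.add_sub_cancel' hmn] at hslow
  have hfrac : ((n - 2 * i : ℕ) : ℝ) / (i * modelProd i) ≤ 1 / K := by
    rw [div_le_div_iff₀ hY hK0, Nat.cast_sub hmn]
    push_cast
    have h1 : (n : ℝ) ≤ 4 * K * i := by nlinarith
    nlinarith
  have hPn := modelProd_pos n
  have hKinv : 1 / (K : ℝ) ≤ 1 := by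
    rw [div_le_one hK0]
    exact_mod_cast hK
  have hslow' : (1 - 1 / (K : ℝ)) * modelProd n ≤ modelProd (2 * i) := by
    refine le_trans ?_ hslow
    rw [mul_comm]
    exact mul_le_mul_of_nonneg_left (by linarith) hPn.le
  have hlen : (1 - 1 / (K : ℝ)) * (n + 1) ≤ n + 1 - (2 * i : ℕ) := by
    have h1 : 2 * (i : ℝ) ≤ n / K := by
      rw [le_div_iff₀ hK0]
      linarith
    have h2 : 0 < 1 / (K : ℝ) := by positivity
    have h3 : (1 - 1 / (K : ℝ)) * (n + 1) = n + 1 - n / K - 1 / K := by ring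
    push_cast
    linarith
  calc (1 - 1 / (K : ℝ)) ^ 2 * ((n + 1) * modelProd n)
      = ((1 - 1 / (K : ℝ)) * modelProd n) * ((1 - 1 / (K : ℝ)) * (n + 1)) := by ring
    _ ≤ modelProd (2 * i) * (n + 1 - (2 * i : ℕ)) :=
      mul_le_mul hslow' hlen (mul_nonneg (by linarith) (by positivity)) (modelProd_pos _).le
    _ ≤ modelF n 1 - 1 := modelProd_mul_sub_le hmn

lemma tendsto_modelF_one_div :
    Tendsto (fun n : ℕ => ((modelF n 1 : ℝ) - 1) / ((n + 1) * modelProd n)) atTop (𝓝 1) := by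
  have hpos : ∀ n : ℕ, 0 < ((n : ℝ) + 1) * modelProd n := fun n =>
    mul_pos (by positivity) (modelProd_pos n)
  rw [tendsto_order]
  constructor
  · intro a ha
    have hlim : Tendsto (fun K : ℕ => (1 - 1 / (K : ℝ)) ^ 2) atTop (𝓝 1) := by
      simpa using (tendsto_one_div_atTop_nhds_zero_nat.const_sub (1 : ℝ)).pow 2
    obtain ⟨K, haK, hK⟩ := ((hlim.eventually_const_lt ha).and (eventually_ge_atTop 1)).exists
    filter_upwards [eventually_le_modelF_one_sub_one hK] with n hn
    exact haK.trans_le ((le_div_iff₀ (hpos n)).2 hn)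
  · intro a ha
    filter_upwards with n
    exact ((div_le_one (hpos n)).2 (modelF_one_sub_one_le n)).trans_lt ha

open Asymptotics in
lemma modelProd_isEquivalent_harmonic :
    modelProd ~[atTop] fun n : ℕ => (harmonic n : ℝ) := by
  have hsum : ∀ n : ℕ, ∑ i ∈ Finset.range n, ((i : ℝ) + 1)⁻¹ = harmonic n := fun n => by
    simp [harmonic]
  have hstep : (fun n : ℕ => modelProd (n + 1) - modelProd n - ((n : ℝ) + 1)⁻¹)
      =o[atTop] fun n : ℕ => ((n : ℝ) + 1)⁻¹ := by
    refine (isLittleO_iff_tendsto' (Eventually.of_forall fun n hn => ?_)).2 ?_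
    · exact absurd hn (by positivity)
    · have h := (tendsto_modelF_one_div.inv₀ one_ne_zero).sub_const 1
      rw [inv_one, sub_self] at h
      refine h.congr fun n => ?_
      have h1 := one_le_modelF_sub_one n
      have h2 : (modelF n 1 : ℝ) - 1 ≠ 0 := by linarith
      have h3 := (modelProd_pos n).ne'
      rw [modelProd_succ_sub]
      field_simp
  have h := hstep.sum_range (fun n => by positivity)
    (by simpa only [hsum] using tendsto_harmonic_atTop)
  have htel : ∀ n : ℕ, ∑ i ∈ Finset.range n, (modelProd (i + 1) - modelProd i - ((i : ℝ) + 1)⁻¹)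
      = modelProd n - modelProd 0 - harmonic n := fun n => by
    rw [Finset.sum_sub_distrib, Finset.sum_range_sub, hsum]
  simp only [htel, hsum] at h
  have hconst : (fun _ : ℕ => modelProd 0) =o[atTop] fun n : ℕ => (harmonic n : ℝ) :=
    isLittleO_const_left.2 (Or.inr (tendsto_norm_atTop_atTop.comp tendsto_harmonic_atTop))
  refine (h.add hconst).congr_left fun n => ?_
  simp only [Pi.sub_apply]
  ring

open Asymptotics in
lemma harmonic_isEquivalent_log_succ :
    (fun n : ℕ => (harmonic n : ℝ)) ~[atTop] fun n : ℕ => Real.log (n + 1) :=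
  (Real.tendsto_harmonic_sub_log_add_one.isBigO_one ℝ).trans_isLittleO
    (isLittleO_const_left.2 (Or.inr (tendsto_norm_atTop_atTop.comp tendsto_log_succ_atTop)))

lemma tendsto_modelProd_div_log :
    Tendsto (fun n : ℕ => modelProd n / Real.log (n + 1)) atTop (𝓝 1) := by
  refine (Asymptotics.isEquivalent_iff_tendsto_one ?_).1
    (modelProd_isEquivalent_harmonic.trans harmonic_isEquivalent_log_succ)
  filter_upwards [tendsto_log_succ_atTop.eventually_gt_atTop 0] with n hn using hn.ne'

end Sieve

/-- Prime number theorem for the model sieve: the `n`-th model prime `x n` is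
asymptotic to `n * log n`. -/
theorem model_sieve_prime_number_theorem :
    Filter.Tendsto (fun n : ℕ => (modelX n : ℝ) / (n * Real.log n))
      Filter.atTop (nhds 1) := by
  rw [← Filter.tendsto_add_atTop_iff_nat 1]
  have hinv : Filter.Tendsto (fun n : ℕ => (((n : ℝ) + 1) * Real.log (n + 1))⁻¹)
      Filter.atTop (nhds 0) :=
    ((Filter.tendsto_atTop_add_const_right _ _ tendsto_natCast_atTop_atTop).atTop_mul_atTop₀
      tendsto_log_succ_atTop).inv_tendsto_atTop
  have h := (tendsto_modelF_one_div.mul tendsto_modelProd_div_log).add hinv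
  rw [mul_one, add_zero] at h
  refine h.congr fun n => ?_
  have hP := (modelProd_pos n).ne'
  simp only [modelX, Nat.add_sub_cancel]
  push_cast
  rw [div_mul_div_comm, mul_right_comm, mul_div_mul_right _ _ hP, ← one_div, ← add_div,
    sub_add_cancel]
end

section
/- Prime number theorem for the model sieve in waiting-time form (Equation #1 of the paper): x (n+1) / (2 + ∑_{j=1}^{n} 1/(d j)) → 1 as n → ∞, where d j = ∏_{i=1}^{j} (1 − 1/(x i)); equivalently, (x (n+1) − 2 − ∑_{j=1}^{n} 1/(d j)) / (2 + ∑_{j=1}^{n} 1/(d j)) = o(1). -/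
theorem add_div_of_eq {b q r : ℕ} (hr : r < b) :
    b * q + r + 1 + (b * q + r + 1 + b - 1) / b = (b + 1) * q + r + 2 := by
  have h : (b * q + r + 1 + b - 1) / b = q + 1 := by
    rw [show b * q + r + 1 + b - 1 = r + b * (q + 1) by rw [mul_add]; omega,
      Nat.add_mul_div_left _ _ (by omega), Nat.div_eq_of_lt hr, zero_add]
  rw [h]; ring

theorem gx_eq_add_div {b : ℕ} (hb : 1 ≤ b) (k : ℕ) :
    gx (b + 1) k = k + (k + b - 1) / b := by
  have hzero : (0 + b - 1) / b = 0 := Nat.div_eq_of_lt (by omega)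
  have hmono : StrictMono (fun k : ℕ => k + (k + b - 1) / b) := by
    intro i j hij
    have : (i + b - 1) / b ≤ (j + b - 1) / b := Nat.div_le_div_right (by omega)
    simp only; omega
  have hsurv : ∀ i : ℕ, (i + (i + b - 1) / b) % (b + 1) ≠ 1 := by
    intro i
    rcases Nat.eq_zero_or_pos i with rfl | hi
    · rw [hzero]; simp
    · have hr : (i - 1) % b < b := Nat.mod_lt _ hb
      have hi' : i = b * ((i - 1) / b) + (i - 1) % b + 1 := by
        rw [Nat.div_add_mod]; omega
      generalize (i - 1) / b = q at hi'
      generalize (i - 1) % b = r at hi' hr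
      rw [hi', add_div_of_eq hr, add_assoc, Nat.mul_add_mod]
      rcases Nat.lt_or_ge (r + 2) (b + 1) with h | h
      · rw [Nat.mod_eq_of_lt h]; omega
      · rw [show r + 2 = b + 1 by omega, Nat.mod_self]; omega
  have hrange : ∀ k : ℕ, k % (b + 1) ≠ 1 → k ∈ Set.range (fun k : ℕ => k + (k + b - 1) / b) := by
    intro k hk
    rcases Nat.eq_zero_or_pos k with rfl | hk0
    · exact ⟨0, by simp only [hzero]⟩
    · have hk1 : k ≠ 1 := by
        rintro rfl
        exact hk (Nat.mod_eq_of_lt (by omega))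
      have hr : (k - 2) % (b + 1) < b + 1 := Nat.mod_lt _ (by omega)
      have hk' : k = (b + 1) * ((k - 2) / (b + 1)) + (k - 2) % (b + 1) + 2 := by
        rw [Nat.div_add_mod]; omega
      generalize (k - 2) / (b + 1) = q at hk'
      generalize (k - 2) % (b + 1) = r at hk' hr
      have hrb : r ≠ b := by
        rintro rfl
        apply hk
        rw [hk', add_assoc, Nat.mul_add_mod, show r + 2 = 1 + (r + 1) by omega, Nat.add_mod_right,
          Nat.mod_eq_of_lt (by omega)]
      exact ⟨b * q + r + 1, by simp only [hk', add_div_of_eq (show r < b by omega)]⟩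
  have hinf : (Set.ofPred fun k : ℕ => k % (b + 1) ≠ 1).Infinite :=
    Set.infinite_of_injective_forall_mem hmono.injective hsurv
  have hnth := Nat.nth_comp_of_strictMono (n := k) hmono hrange fun h => absurd h hinf
  rw [gx, ← hnth, Nat.nth_of_forall fun i _ => hsurv i]

theorem modelF_strictMono_and_two_le (n : ℕ) : StrictMono (modelF n) ∧ 2 ≤ modelF n 1 := by
  induction n with
  | zero => exact ⟨fun i j h => by simpa [modelF] using h, by simp [modelF]⟩
  | succ n ih =>
    obtain ⟨hmono, hx⟩ := ih
    obtain ⟨b, hb⟩ : ∃ b, modelF n 1 = b + 1 := ⟨modelF n 1 - 1, by omega⟩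
    have hstep : ∀ k, modelF (n + 1) k = modelF n (k + (k + b - 1) / b) := fun k => by
      rw [modelF, hb, gx_eq_add_div (by omega)]
    refine ⟨fun i j hij => ?_, ?_⟩
    · rw [hstep, hstep]
      refine hmono ?_
      have : (i + b - 1) / b ≤ (j + b - 1) / b := Nat.div_le_div_right (by omega)
      omega
    · rw [hstep]
      exact hx.trans (hmono.monotone (Nat.le_add_right _ _))

/-- The successive positions, in the lists produced by the first stages of the sieve, of the number
occupying position `k` after `n` stages. -/
theorem exists_position_trace (n k : ℕ) : ∃ K : ℕ → ℕ, K n = k ∧ K 0 + 1 = modelF n k ∧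
    ∀ m < n, K m = gx (modelF m 1) (K (m + 1)) := by
  induction n generalizing k with
  | zero => exact ⟨fun _ => k, rfl, by simp [modelF], by simp⟩
  | succ n ih =>
    obtain ⟨K, hn, h0, hK⟩ := ih (gx (modelF n 1) k)
    refine ⟨fun m => if m ≤ n then K m else k, by simp, by simpa [modelF] using h0, ?_⟩
    intro m hm
    rcases Nat.lt_or_ge m n with h | h
    · simpa [h.le, Nat.succ_le_of_lt h] using hK m h
    · obtain rfl : m = n := by omega
      simpa using hn

/-- The reciprocal of the density left after `n` stages of the sieve. -/
noncomputable def invDensity (n : ℕ) : ℝ :=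
  1 / ∏ i ∈ Finset.range n, (1 - 1 / (modelF i 1 : ℝ))

theorem two_le_modelF_cast (n : ℕ) : (2 : ℝ) ≤ modelF n 1 := by
  exact_mod_cast (modelF_strictMono_and_two_le n).2

theorem one_sub_inv_modelF_pos (n : ℕ) : (0 : ℝ) < 1 - 1 / (modelF n 1 : ℝ) := by
  have h := two_le_modelF_cast n
  have : 1 / (modelF n 1 : ℝ) < 1 := by rw [div_lt_one] <;> linarith
  linarith

theorem invDensity_zero : invDensity 0 = 1 := by simp [invDensity]

theorem invDensity_pos (n : ℕ) : 0 < invDensity n :=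
  one_div_pos.2 (Finset.prod_pos fun i _ => one_sub_inv_modelF_pos i)

theorem invDensity_succ_sub (n : ℕ) :
    invDensity (n + 1) - invDensity n = invDensity (n + 1) / modelF n 1 := by
  have h := (one_sub_inv_modelF_pos n).ne'
  have hp : (∏ i ∈ Finset.range n, (1 - 1 / (modelF i 1 : ℝ))) ≠ 0 :=
    (Finset.prod_pos fun i _ => one_sub_inv_modelF_pos i).ne'
  have : invDensity (n + 1) * (1 - 1 / (modelF n 1 : ℝ)) = invDensity n := by
    rw [invDensity, invDensity, Finset.prod_range_succ]
    field_simp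
  rw [← this]; ring

theorem invDensity_monotone : Monotone invDensity :=
  monotone_nat_of_le_succ fun n => by
    have := invDensity_succ_sub n
    have := div_nonneg (invDensity_pos (n + 1)).le (Nat.cast_nonneg (α := ℝ) (modelF n 1))
    linarith

theorem one_le_invDensity (n : ℕ) : 1 ≤ invDensity n :=
  invDensity_zero ▸ invDensity_monotone (Nat.zero_le n)

/-- The real-valued data attached to the positions of the `n`-th model prime. -/
theorem exists_weighted_positions (n : ℕ) : ∃ K : ℕ → ℝ, K n = 1 ∧ K 0 + 1 = modelF n 1 ∧
    (∀ m < n, K (m + 1) + 1 ≤ K m) ∧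
    (∀ m < n, K (m + 1) * invDensity (m + 1) ≤ K m * invDensity m) ∧
    (∀ m < n, K m * invDensity m ≤ K (m + 1) * invDensity (m + 1) +
      (invDensity (m + 1) - 2 * (invDensity (m + 1) - invDensity m))) ∧
    (∀ m < n, K (m + 1) * invDensity (m + 1) + (1 - K m / modelF m 1) * invDensity (m + 1) ≤
      K m * invDensity m) := by
  obtain ⟨K, hn, h0, hK⟩ := exists_position_trace n 1
  have hpos : ∀ m ≤ n, 1 ≤ K m := by
    intro m hm
    induction hm using Nat.decreasingInduction with
    | self => exact hn.ge
    | of_succ m hm ih =>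
      have hx := (modelF_strictMono_and_two_le m).2
      obtain ⟨b, hb⟩ : ∃ b, modelF m 1 = b + 1 := ⟨modelF m 1 - 1, by omega⟩
      rw [hK m hm, hb, gx_eq_add_div (by omega)]
      exact ih.trans (Nat.le_add_right _ _)
  have key : ∀ m < n, ∃ b q : ℝ, 1 ≤ b ∧ (modelF m 1 : ℝ) = b + 1 ∧ (K m : ℝ) = K (m + 1) + q ∧
      1 ≤ q ∧ (K (m + 1) : ℝ) ≤ b * q ∧ b * q ≤ K (m + 1) + b - 1 := by
    intro m hm
    have hx := (modelF_strictMono_and_two_le m).2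
    have hk := hpos (m + 1) hm
    obtain ⟨b, hb⟩ : ∃ b, modelF m 1 = b + 1 := ⟨modelF m 1 - 1, by omega⟩
    have hKm := hK m hm
    rw [hb, gx_eq_add_div (by omega)] at hKm
    have hb1 : 1 ≤ b := by omega
    have h1 : 1 ≤ (K (m + 1) + b - 1) / b := (Nat.one_le_div_iff hb1).2 (by omega)
    have h2 : b * ((K (m + 1) + b - 1) / b) ≤ K (m + 1) + b - 1 := Nat.mul_div_le _ _
    have h3 := Nat.lt_mul_div_succ (K (m + 1) + b - 1) hb1
    rw [mul_add] at h3
    generalize (K (m + 1) + b - 1) / b = q at *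
    refine ⟨b, q, by exact_mod_cast hb1, by rw [hb]; push_cast; rfl, by rw [hKm]; push_cast; rfl,
      by exact_mod_cast h1, ?_, ?_⟩
    · have : K (m + 1) ≤ b * q := by omega
      exact_mod_cast this
    · have : b * q + 1 ≤ K (m + 1) + b := by omega
      have : (b * q + 1 : ℝ) ≤ K (m + 1) + b := by exact_mod_cast this
      linarith
  have hE : ∀ m, ∀ b : ℝ, 1 ≤ b → (modelF m 1 : ℝ) = b + 1 →
      ∃ e, 0 < e ∧ invDensity (m + 1) = (b + 1) * e ∧ invDensity m = b * e := by
    intro m b hb hx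
    have h := invDensity_succ_sub m
    have hp := invDensity_pos (m + 1)
    have hb' : 0 < b + 1 := by linarith
    refine ⟨invDensity (m + 1) / (b + 1), by positivity, by field_simp, ?_⟩
    rw [hx] at h
    rw [sub_eq_iff_eq_add'] at h
    field_simp at h ⊢
    linarith
  refine ⟨fun m => K m, by simp [hn], by rw [← h0]; push_cast; rfl, ?_, ?_, ?_, ?_⟩ <;> intro m hm <;>
    obtain ⟨b, q, hb, hx, hKm, hq, hlo, hhi⟩ := key m hm <;>
    obtain ⟨e, he, he1, he0⟩ := hE m b hb hx <;> simp only
  · linarith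
  · rw [he1, he0, hKm]
    nlinarith
  · rw [he1, he0, hKm]
    nlinarith
  · rw [he1, he0, hx]
    have : (1 - (K m : ℝ) / (b + 1)) * ((b + 1) * e) = (b + 1 - K m) * e := by
      field_simp
    rw [this, hKm]
    nlinarith [mul_nonneg (mul_nonneg he.le (by linarith : 0 ≤ b + 1)) (sub_nonneg.2 hq)]

theorem modelF_one_le (n : ℕ) :
    (modelF n 1 : ℝ) ≤ 2 + ∑ j ∈ Finset.range n, invDensity (j + 1) := by
  obtain ⟨K, hn, h0, -, -, hup, -⟩ := exists_weighted_positions n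
  have h : ∀ m ≤ n, K 0 * invDensity 0 ≤ K m * invDensity m +
      ∑ j ∈ Finset.range m, invDensity (j + 1) - 2 * (invDensity m - 1) := by
    intro m hm
    induction m with
    | zero => simp [invDensity_zero]
    | succ m ih =>
      have := ih (by omega)
      have := hup m hm
      rw [Finset.sum_range_succ]
      linarith
  have h := h n le_rfl
  have := one_le_invDensity n
  rw [hn, invDensity_zero] at h
  linarith

theorem sum_invDensity_le (n : ℕ) :
    ∑ j ∈ Finset.range n, invDensity (j + 1) ≤ n * invDensity n := by
  calc _ ≤ ∑ j ∈ Finset.range n, invDensity n :=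
        Finset.sum_le_sum fun j hj => invDensity_monotone (Finset.mem_range.1 hj)
    _ = _ := by simp

theorem le_sum_invDensity_sub {N n : ℕ} (h : N ≤ n) :
    (n - N : ℝ) * invDensity N ≤ ∑ j ∈ Finset.range n, invDensity (j + 1) -
      ∑ j ∈ Finset.range N, invDensity (j + 1) := by
  induction n, h using Nat.le_induction with
  | base => simp
  | succ n h ih =>
    have := invDensity_monotone (show N ≤ n + 1 by omega)
    rw [Finset.sum_range_succ]
    push_cast
    linarith

theorem mul_invDensity_le {K : ℕ → ℝ} {n : ℕ}
    (h : ∀ m < n, K (m + 1) * invDensity (m + 1) ≤ K m * invDensity m) {m : ℕ} (hm : m ≤ n) :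
    K m * invDensity m ≤ K 0 := by
  induction m with
  | zero => simp [invDensity_zero]
  | succ m ih => exact (h m hm).trans (ih (by omega))

theorem sub_add_one_mul_invDensity_le {m n : ℕ} (hm : m ≤ n) :
    (n - m + 1 : ℝ) * invDensity m + 1 ≤ modelF n 1 := by
  obtain ⟨K, hn, h0, hstep, hanti, -, -⟩ := exists_weighted_positions n
  have h : ∀ m ≤ n, (n - m + 1 : ℝ) ≤ K m := by
    intro m hm
    induction hm using Nat.decreasingInduction with
    | self => simp [hn]
    | of_succ m hm ih =>
      have := hstep m hm
      push_cast at ih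
      linarith
  have := mul_le_mul_of_nonneg_right (h m hm) (invDensity_pos m).le
  have := mul_invDensity_le hanti hm
  linarith

theorem add_two_le_modelF (n : ℕ) : (n + 2 : ℝ) ≤ modelF n 1 := by
  have := sub_add_one_mul_invDensity_le (Nat.zero_le n)
  rw [invDensity_zero] at this
  push_cast at this
  linarith

theorem invDensity_div_antitone : Antitone fun n : ℕ => invDensity n / (n + 1) := by
  refine antitone_nat_of_succ_le fun n => ?_
  have h := invDensity_succ_sub n
  have hp := invDensity_pos (n + 1)
  have : invDensity (n + 1) / modelF n 1 ≤ invDensity (n + 1) / (n + 2) :=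
    div_le_div_of_nonneg_left hp.le (by positivity) (add_two_le_modelF n)
  have h2 : invDensity (n + 1) - invDensity (n + 1) / (n + 2) =
      invDensity (n + 1) / (n + 2) * (n + 1) := by
    field_simp; ring
  rw [le_div_iff₀ (by positivity)]
  push_cast
  rw [add_assoc, one_add_one_eq_two]
  linarith

theorem exists_le_invDensity (R : ℝ) : ∃ m, R ≤ invDensity m := by
  by_contra! hR
  have hR1 : 1 < R := (one_le_invDensity 0).trans_lt (hR 0)
  set C := R + 2 with hC
  have hCpos : 0 < C := by linarith
  have hstep : ∀ n : ℕ, C⁻¹ * (1 / (n + 1 : ℝ)) ≤ invDensity (n + 1) - invDensity n := by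
    intro n
    rw [invDensity_succ_sub, inv_mul_eq_div, div_div]
    have h1 : (modelF n 1 : ℝ) ≤ (n + 1) * C := by
      have := modelF_one_le n
      have := sum_invDensity_le n
      have := mul_le_mul_of_nonneg_left (hR n).le (Nat.cast_nonneg (α := ℝ) n)
      have : (0 : ℝ) ≤ n := Nat.cast_nonneg n
      rw [hC]
      linarith
    exact div_le_div₀ (invDensity_pos _).le (one_le_invDensity _)
      (by linarith [two_le_modelF_cast n]) h1
  have hsum : ∀ n : ℕ, C⁻¹ * ∑ i ∈ Finset.range n, 1 / (i + 1 : ℝ) ≤ R := by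
    intro n
    rw [Finset.mul_sum]
    calc _ ≤ ∑ i ∈ Finset.range n, (invDensity (i + 1) - invDensity i) :=
          Finset.sum_le_sum fun i _ => hstep i
      _ = invDensity n - invDensity 0 := Finset.sum_range_sub _ _
      _ ≤ R := by linarith [hR n, invDensity_pos 0]
  obtain ⟨n, hn⟩ :=
    (Real.tendsto_sum_range_one_div_nat_succ_atTop.eventually_gt_atTop (C * R)).exists
  have := hsum n
  rw [inv_mul_le_iff₀ hCpos] at this
  linarith

theorem eventually_mul_le_modelF (R : ℝ) (hR : 0 ≤ R) :
    ∀ᶠ n : ℕ in Filter.atTop, R * (n + 1) ≤ modelF n 1 := by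
  obtain ⟨m, hm⟩ := exists_le_invDensity (2 * R)
  filter_upwards [Filter.eventually_ge_atTop (2 * m)] with n hn
  have h := sub_add_one_mul_invDensity_le (show m ≤ n by omega)
  have hn' : (2 * m : ℝ) ≤ n := by exact_mod_cast hn
  have : (n - m + 1 : ℝ) * (2 * R) ≤ (n - m + 1 : ℝ) * invDensity m :=
    mul_le_mul_of_nonneg_left hm (by linarith [Nat.cast_nonneg (α := ℝ) m])
  nlinarith

/-- A position in the late stages is small compared with the sieving prime. -/
theorem eventually_position_bound (M : ℕ) (hM : 1 ≤ M) : ∀ᶠ n : ℕ in Filter.atTop,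
    ∀ m < n, n / M ≤ m → ∀ k : ℝ, k * invDensity m + 1 ≤ modelF n 1 →
      k / modelF m 1 ≤ 1 / M := by
  have hM0 : (0 : ℝ) < M := by exact_mod_cast hM
  obtain ⟨J, hJ⟩ := Filter.eventually_atTop.1
    (eventually_mul_le_modelF (2 * M ^ 3) (by positivity))
  filter_upwards [Filter.eventually_ge_atTop (J * M)] with n hn m hmn hm k hk
  have hx := hJ m (((Nat.le_div_iff_mul_le hM).2 hn).trans hm)
  have hm1 : (n + 1 : ℝ) ≤ M * (m + 1) := by
    have : n < (m + 1) * M := (Nat.div_lt_iff_lt_mul hM).1 (by omega)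
    have : n + 1 ≤ M * (m + 1) := by rw [mul_comm]; omega
    exact_mod_cast this
  have hE : invDensity n ≤ M * invDensity m := by
    have h := invDensity_div_antitone hmn.le
    simp only at h
    rw [div_le_div_iff₀ (by positivity) (by positivity)] at h
    have h2 := mul_le_mul_of_nonneg_left hm1 (invDensity_pos m).le
    refine le_of_mul_le_mul_right (a := (m + 1 : ℝ)) ?_ (by positivity)
    linarith
  have hkm : k ≤ (n + 1) * M := by
    refine le_of_mul_le_mul_right (a := invDensity m) ?_ (invDensity_pos m)
    have h1 := modelF_one_le n
    have h2 := sum_invDensity_le n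
    have h3 := one_le_invDensity n
    have h4 := mul_le_mul_of_nonneg_left hE (show (0 : ℝ) ≤ n + 1 by positivity)
    linarith
  have hk2 : k ≤ 2 * M ^ 2 * (m + 1) := by
    have := mul_le_mul_of_nonneg_right hm1 hM0.le
    have : (0 : ℝ) ≤ M ^ 2 * (m + 1) := by positivity
    linarith
  rw [div_le_div_iff₀ (by linarith [two_le_modelF_cast m]) hM0]
  have := mul_le_mul_of_nonneg_right hk2 hM0.le
  linarith

theorem eventually_le_modelF_one (M : ℕ) (hM : 2 ≤ M) : ∀ᶠ n : ℕ in Filter.atTop,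
    (1 - 1 / (M : ℝ)) * (1 - 1 / (M - 1 : ℝ)) *
      (2 + ∑ j ∈ Finset.range n, invDensity (j + 1)) ≤ modelF n 1 := by
  have hM2 : (2 : ℝ) ≤ M := by exact_mod_cast hM
  filter_upwards [eventually_position_bound M (by omega)] with n hbound
  obtain ⟨K, hn, h0, -, hanti, -, hlow⟩ := exists_weighted_positions n
  set T : ℕ → ℝ := fun m => ∑ j ∈ Finset.range m, invDensity (j + 1) with hT
  set N := n / M with hN
  have hNn : N ≤ n := Nat.div_le_self _ _
  have hc0 : (0 : ℝ) ≤ 1 - 1 / M := by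
    rw [sub_nonneg, div_le_one] <;> linarith
  have hc1 : (0 : ℝ) ≤ 1 - 1 / (M - 1) := by
    rw [sub_nonneg, div_le_one] <;> linarith
  have hsum : ∀ m, N ≤ m → m ≤ n →
      K m * invDensity m + (1 - 1 / (M : ℝ)) * (T m - T N) ≤ K 0 := by
    intro m hm
    induction m, hm using Nat.le_induction with
    | base => intro h; simpa using mul_invDensity_le hanti h
    | succ m hm ih =>
      intro hmn
      have h1 := ih (by omega)
      have h2 := hlow m hmn
      have h3 := hbound m hmn hm (K m) (by linarith [mul_invDensity_le hanti (m := m) (by omega)])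
      have h4 := mul_le_mul_of_nonneg_right (sub_le_sub_left h3 1) (invDensity_pos (m + 1)).le
      have h5 : T (m + 1) = T m + invDensity (m + 1) := Finset.sum_range_succ _ _
      rw [h5]
      linarith
  have hTN : T N * (M - 1) ≤ T n := by
    have h1 := sum_invDensity_le N
    have h2 := le_sum_invDensity_sub hNn
    have h3 : (M - 1 : ℝ) * N ≤ n - N := by
      have : (N * M : ℝ) ≤ n := by exact_mod_cast Nat.div_mul_le_self n M
      linarith
    have h4 := mul_le_mul_of_nonneg_right h3 (invDensity_pos N).le
    have h5 := mul_le_mul_of_nonneg_right h1 (show (0 : ℝ) ≤ M - 1 by linarith)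
    have h6 : 0 ≤ T N := Finset.sum_nonneg fun j _ => (invDensity_pos _).le
    change (n - N : ℝ) * invDensity N ≤ T n - T N at h2
    change T N * (M - 1) ≤ _ at h5
    linarith
  have hTN' : (1 - 1 / (M - 1 : ℝ)) * T n ≤ T n - T N := by
    have : T N ≤ T n / (M - 1) := by rwa [le_div_iff₀ (by linarith)]
    have h : (1 - 1 / (M - 1 : ℝ)) * T n = T n - T n / (M - 1) := by ring
    linarith
  have h1 := hsum n hNn le_rfl
  have h2 := mul_le_mul_of_nonneg_left hTN' hc0
  have h3 : (1 - 1 / (M : ℝ)) * (1 - 1 / (M - 1 : ℝ)) ≤ 1 :=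
    mul_le_one₀ (by simp) hc1 (by simp; linarith)
  rw [hn] at h1
  have := one_le_invDensity n
  linarith

theorem tendsto_modelF_one_div_s10 : Filter.Tendsto
    (fun n : ℕ => (modelF n 1 : ℝ) / (2 + ∑ j ∈ Finset.range n, invDensity (j + 1)))
    Filter.atTop (nhds 1) := by
  have hpos : ∀ n : ℕ, 0 < 2 + ∑ j ∈ Finset.range n, invDensity (j + 1) := fun n => by
    have : 0 ≤ ∑ j ∈ Finset.range n, invDensity (j + 1) :=
      Finset.sum_nonneg fun j _ => (invDensity_pos _).le
    linarith
  have hlim : Filter.Tendsto (fun M : ℕ => (1 - 1 / (M : ℝ)) * (1 - 1 / (M - 1 : ℝ)))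
      Filter.atTop (nhds 1) := by
    have h1 : Filter.Tendsto (fun M : ℕ => 1 / (M : ℝ)) Filter.atTop (nhds 0) :=
      tendsto_one_div_atTop_nhds_zero_nat
    have h2 : Filter.Tendsto (fun M : ℕ => 1 / (M - 1 : ℝ)) Filter.atTop (nhds 0) := by
      refine Filter.Tendsto.const_div_atTop ?_ 1
      exact Filter.tendsto_atTop_add_const_right _ (-1) tendsto_natCast_atTop_atTop
    simpa using (h1.const_sub 1).mul (h2.const_sub 1)
  rw [tendsto_order]
  refine ⟨fun a ha => ?_, fun a ha => Filter.Eventually.of_forall fun n => ?_⟩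
  · obtain ⟨M, hMa, hM⟩ :=
      ((hlim.eventually_const_lt ha).and (Filter.eventually_ge_atTop 2)).exists
    filter_upwards [eventually_le_modelF_one M hM] with n hn
    exact hMa.trans_le ((le_div_iff₀ (hpos n)).2 hn)
  · exact ((div_le_one (hpos n)).2 (modelF_one_le n)).trans_lt ha

/-- Prime number theorem for the model sieve in waiting-time form (Equation #1):
`x (n+1) / (2 + ∑_{j=1}^{n} 1/(d j)) → 1`, where `d j = ∏_{i=1}^{j} (1 - 1/(x i))`. -/
theorem model_sieve_waiting_time_pnt :
    Filter.Tendsto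
      (fun n : ℕ => (modelX (n + 1) : ℝ) /
        (2 + ∑ j ∈ Finset.Icc 1 n, 1 / ∏ i ∈ Finset.Icc 1 j, (1 - 1 / (modelX i : ℝ))))
      Filter.atTop (nhds 1) := by
  have hprod : ∀ j : ℕ, ∏ i ∈ Finset.Icc 1 j, (1 - 1 / (modelX i : ℝ)) =
      ∏ i ∈ Finset.range j, (1 - 1 / (modelF i 1 : ℝ)) := fun j => by
    induction j with
    | zero => simp
    | succ j ih => rw [Finset.prod_Icc_succ_top (by omega), ih, Finset.prod_range_succ]; rfl
  have hsum : ∀ n : ℕ, ∑ j ∈ Finset.Icc 1 n,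
      1 / ∏ i ∈ Finset.Icc 1 j, (1 - 1 / (modelX i : ℝ)) =
      ∑ j ∈ Finset.range n, invDensity (j + 1) := fun n => by
    induction n with
    | zero => simp
    | succ n ih =>
      rw [Finset.sum_Icc_succ_top (by omega), ih, Finset.sum_range_succ, hprod]; rfl
  refine tendsto_modelF_one_div_s10.congr fun n => ?_
  rw [hsum]; rfl
end

section
/- Let p i denote the i-th prime and d i = ∏_{j=1}^{i} (1 − 1/(p j)). Then (1/n) · ∑_{i=1}^{n} ((p (i+1) − p i) · d i − 1) → e^{−γ} − 1 as n → ∞, where γ is the Euler–Mascheroni constant; that is, on average the normalized prime gap (p (i+1) − p i)·d i falls short of 1 by about 1 − e^{−γ} ≈ 0.44. -/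
section

open MeasureTheory Set Filter Topology Chebyshev
open ArithmeticFunction hiding log

/-- The Fejér kernel, as the cosine transform of the triangle function. -/
noncomputable def fejer (u : ℝ) : ℝ := 2 * ∫ y in (0 : ℝ)..1, (1 - y) * Real.cos (y * u)

lemma continuous_fejer : Continuous fejer := by
  unfold fejer
  refine continuous_const.mul ?_
  exact intervalIntegral.continuous_parametric_intervalIntegral_of_continuous' (by fun_prop) _ _

lemma fejer_eq {u : ℝ} (hu : u ≠ 0) : fejer u = 2 * (1 - Real.cos u) / u ^ 2 := by
  have h : ∀ y ∈ uIcc (0 : ℝ) 1, HasDerivAt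
      (fun y ↦ (1 - y) * Real.sin (y * u) / u - Real.cos (y * u) / u ^ 2)
      ((1 - y) * Real.cos (y * u)) y := by
    intro y _
    have h1 : HasDerivAt (fun y : ℝ ↦ y * u) u y := by
      simpa using (hasDerivAt_id y).mul_const u
    have h2 : HasDerivAt (fun y : ℝ ↦ 1 - y) (-1) y := by
      simpa using (hasDerivAt_id y).const_sub 1
    refine (((h2.mul h1.sin).div_const u).sub (h1.cos.div_const (u ^ 2))).congr_deriv ?_
    field
  rw [fejer, intervalIntegral.integral_eq_sub_of_hasDerivAt h
    (Continuous.intervalIntegrable (by fun_prop) _ _)]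
  simp
  field

lemma fejer_zero : fejer 0 = 1 := by
  have : ∫ y in (0 : ℝ)..1, (1 - y) = 1 / 2 := by
    rw [intervalIntegral.integral_sub (by simp) (by simp)]
    simp
    norm_num
  simp [fejer, this]

lemma fejer_nonneg (u : ℝ) : 0 ≤ fejer u := by
  rcases eq_or_ne u 0 with rfl | hu
  · simp [fejer_zero]
  · rw [fejer_eq hu]
    have := Real.cos_le_one u
    have : 0 ≤ 1 - Real.cos u := by linarith
    positivity

lemma fejer_le (u : ℝ) : fejer u ≤ 5 * (1 + u ^ 2)⁻¹ := by
  rcases eq_or_ne u 0 with rfl | hu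
  · simp [fejer_zero]
  · rw [fejer_eq hu, ← div_eq_mul_inv, div_le_div_iff₀ (by positivity) (by positivity)]
    have h1 := Real.neg_one_le_cos u
    have h2 := Real.one_sub_sq_div_two_le_cos (x := u)
    nlinarith [sq_nonneg u]

lemma integrable_fejer : Integrable fejer := by
  refine (integrable_inv_one_add_sq.const_mul 5).mono' continuous_fejer.aestronglyMeasurable ?_
  filter_upwards with u
  rw [Real.norm_of_nonneg (fejer_nonneg u)]
  exact fejer_le u

lemma integral_fejer_pos : 0 < ∫ u, fejer u :=
  integral_pos_of_integrable_nonneg_nonzero continuous_fejer integrable_fejer fejer_nonneg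
    (by rw [fejer_zero]; exact one_ne_zero)

/-- A bounded function whose averages against rescaled Fejér kernels vanish at infinity cannot be
bounded below by a fixed positive number on intervals of fixed length arbitrarily far out. -/
lemma eventually_exists_lt_of_tendsto_fejer {g : ℝ → ℝ} (hg : Measurable g) {C : ℝ}
    (hC : ∀ t, |g t| ≤ C)
    (h : ∀ a > 0, Tendsto (fun T ↦ ∫ u, g (T - u / a) * fejer u) atTop (𝓝 0))
    {ε δ : ℝ} (hε : 0 < ε) (hδ : 0 < δ) :
    ∀ᶠ T in atTop, ∃ v, |v| ≤ δ ∧ g (T - v) < ε := by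
  have hm := integral_fejer_pos
  set m := ∫ u, fejer u
  have htail : Tendsto (fun a : ℝ ↦ ∫ u, (ε + C) * ({u | a * δ < |u|}.indicator fejer u)) atTop
      (𝓝 (∫ _u : ℝ, (0 : ℝ))) := by
    refine tendsto_integral_filter_of_dominated_convergence (fun u ↦ |ε + C| * fejer u) ?_ ?_
      (integrable_fejer.const_mul _) ?_
    · filter_upwards with a
      exact (continuous_fejer.measurable.indicator
        (measurableSet_lt measurable_const (by fun_prop))).aestronglyMeasurable.const_mul _
    · filter_upwards with a
      filter_upwards with u
      rw [norm_mul, Real.norm_eq_abs]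
      gcongr
      refine (norm_indicator_le_norm_self _ _).trans ?_
      rw [Real.norm_of_nonneg (fejer_nonneg u)]
    · filter_upwards with u
      refine tendsto_const_nhds.congr' ?_
      filter_upwards [eventually_ge_atTop (|u| / δ)] with a ha
      rw [indicator_of_notMem, mul_zero]
      simp only [mem_ofPred_eq, not_lt]
      rwa [div_le_iff₀ hδ] at ha
  rw [integral_zero] at htail
  obtain ⟨a, ha, ha0⟩ := ((htail.eventually_lt_const (u := ε * m / 2) (by positivity)).and
    (eventually_gt_atTop 0)).exists
  filter_upwards [(h a ha0).eventually_lt_const (u := ε * m / 2) (by positivity)] with T hT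
  by_contra! hcon
  have hind : Integrable ({u | a * δ < |u|}.indicator fejer) :=
    integrable_fejer.indicator (measurableSet_lt measurable_const (by fun_prop))
  have hle : ∫ u, (ε * fejer u - (ε + C) * ({u | a * δ < |u|}.indicator fejer u)) ≤
      ∫ u, g (T - u / a) * fejer u := by
    refine integral_mono ((integrable_fejer.const_mul _).sub (hind.const_mul _)) ?_ ?_
    · refine integrable_fejer.bdd_mul (c := C) (hg.comp (by fun_prop)).aestronglyMeasurable ?_
      filter_upwards with u using hC _
    · intro u
      have hK := fejer_nonneg u
      by_cases hu : a * δ < |u|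
      · have := (abs_le.mp (hC (T - u / a))).1
        simp only [indicator_of_mem (show u ∈ {u | a * δ < |u|} from hu)]
        nlinarith
      · simp only [indicator_of_notMem (show u ∉ {u | a * δ < |u|} from hu)]
        have := hcon (u / a) (by
          rw [abs_div, abs_of_pos ha0, div_le_iff₀ ha0]; linarith)
        nlinarith
  rw [integral_sub (integrable_fejer.const_mul _) (hind.const_mul _), integral_const_mul] at hle
  change ε * m - _ ≤ _ at hle
  linarith

/-- **Tauberian step**: convergence of Fejér means plus slow decrease gives convergence. -/
lemma tendsto_zero_of_tendsto_fejer {g : ℝ → ℝ} (hg : Measurable g) {C : ℝ}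
    (hC : ∀ t, |g t| ≤ C)
    (h : ∀ a > 0, Tendsto (fun T ↦ ∫ u, g (T - u / a) * fejer u) atTop (𝓝 0))
    (hmono : ∀ s t, 0 < s → s ≤ t → (g s + 1) * Real.exp (-(t - s)) ≤ g t + 1) :
    Tendsto g atTop (𝓝 0) := by
  have hneg : ∀ a > 0, Tendsto (fun T ↦ ∫ u, (-g) (T - u / a) * fejer u) atTop (𝓝 0) := by
    intro a ha
    simpa [integral_neg] using (h a ha).neg
  have key : ∀ ε : ℝ, 0 < ε → ∃ δ > 0, (1 + ε) * Real.exp (-(2 * δ)) ≥ 1 + ε / 2 ∧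
      1 - ε / 2 ≥ (1 - ε) * Real.exp (2 * δ) := by
    intro ε hε
    have h1 : ContinuousAt (fun δ : ℝ ↦ (1 + ε) * Real.exp (-(2 * δ))) 0 := by fun_prop
    have h2 : ContinuousAt (fun δ : ℝ ↦ (1 - ε) * Real.exp (2 * δ)) 0 := by fun_prop
    have h3 := (h1.eventually_const_lt (u := 1 + ε / 2) (by simp; linarith)).and
      (h2.eventually_lt_const (u := 1 - ε / 2) (by simp; linarith))
    obtain ⟨δ, ⟨h4, h5⟩, hδ⟩ := ((h3.filter_mono nhdsWithin_le_nhds).and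
      (self_mem_nhdsWithin (s := Ioi (0 : ℝ)))).exists
    exact ⟨δ, hδ, h4.le, h5.le⟩
  refine Metric.tendsto_nhds.mpr fun ε hε ↦ ?_
  obtain ⟨δ, hδ, h1, h2⟩ := key ε hε
  have hshift (c : ℝ) : Tendsto (fun t : ℝ ↦ t + c) atTop atTop :=
    tendsto_atTop_add_const_right _ _ tendsto_id
  filter_upwards [(hshift δ).eventually (eventually_exists_lt_of_tendsto_fejer hg hC h
      (half_pos hε) hδ),
    (hshift (-δ)).eventually (eventually_exists_lt_of_tendsto_fejer hg.neg (C := C)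
      (by simpa using hC) hneg (half_pos hε) hδ), eventually_gt_atTop (2 * δ)] with t hup hlo ht
  obtain ⟨v, hv, hup⟩ := hup
  obtain ⟨w, hw, hlo⟩ := hlo
  rw [abs_le] at hv hw
  rw [Real.dist_eq, sub_zero, abs_lt]
  constructor
  · by_contra! hcon
    have h3 := hmono (t + -δ - w) t (by linarith) (by linarith)
    rw [Real.exp_neg, ← div_eq_mul_inv, div_le_iff₀ (Real.exp_pos _)] at h3
    have h4 : Real.exp (t - (t + -δ - w)) ≤ Real.exp (2 * δ) := Real.exp_le_exp.mpr (by linarith)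
    have h5 : 0 < Real.exp (t - (t + -δ - w)) := Real.exp_pos _
    simp only [Pi.neg_apply] at hlo
    have h6 : 1 ≤ Real.exp (2 * δ) := Real.one_le_exp (by linarith)
    rcases le_total (1 - ε) 0 with h7 | h7
    · have : (g t + 1) * Real.exp (t - (t + -δ - w)) ≤ (1 - ε) * 1 := by
        have : 1 ≤ Real.exp (t - (t + -δ - w)) := Real.one_le_exp (by linarith)
        nlinarith
      linarith
    · nlinarith
  · by_contra! hcon
    have h3 := hmono t (t + δ - v) (by linarith) (by linarith)
    have h4 : Real.exp (-(2 * δ)) ≤ Real.exp (-(t + δ - v - t)) :=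
      Real.exp_le_exp.mpr (by linarith)
    have h5 : 0 < Real.exp (-(2 * δ)) := Real.exp_pos _
    nlinarith

lemma integral_mul_fejer_eq (g : ℝ → ℝ) (hg0 : ∀ t ≤ 0, g t = 0) {a : ℝ} (ha : 0 < a) (T : ℝ) :
    ∫ u, g (T - u / a) * fejer u = a * ∫ t in Ioi 0, g t * fejer (a * (T - t)) := by
  have h1 : ∫ t in Ioi 0, g t * fejer (a * (T - t)) = ∫ t, g t * fejer (a * (T - t)) := by
    refine setIntegral_eq_integral_of_forall_compl_eq_zero fun t ht ↦ ?_
    rw [hg0 t (by simpa using ht), zero_mul]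
  rw [h1, ← integral_sub_left_eq_self (fun t ↦ g t * fejer (a * (T - t))) volume T]
  have := Measure.integral_comp_mul_left (fun u ↦ g (T - u / a) * fejer u) a
  rw [abs_of_pos (inv_pos.mpr ha), smul_eq_mul] at this
  rw [← mul_right_inj' (inv_ne_zero ha.ne'), ← this, ← mul_assoc, inv_mul_cancel₀ ha.ne', one_mul]
  congr 1 with t
  simp [mul_div_cancel_left₀ _ ha.ne']

lemma fejer_eq_re (u : ℝ) :
    fejer u = (∫ y in Ioc (0 : ℝ) 1, 2 * (1 - (y : ℂ)) * Complex.exp (Complex.I * (y * u))).re := by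
  rw [fejer, intervalIntegral.integral_of_le zero_le_one, ← integral_const_mul]
  have h_int : Integrable (fun y : ℝ ↦ 2 * (1 - (y : ℂ)) * Complex.exp (Complex.I * (y * u)))
      (volume.restrict (Ioc 0 1)) :=
    (Continuous.integrableOn_Icc (by fun_prop)).mono_set Ioc_subset_Icc_self
  have := integral_re h_int
  simp only [RCLike.re_eq_complex_re] at this
  rw [← this]
  congr 1 with y
  rw [show 2 * (1 - (y : ℂ)) = (2 * (1 - y) : ℝ) by push_cast; ring, Complex.re_ofReal_mul,
    mul_comm Complex.I, ← Complex.ofReal_mul, Complex.exp_ofReal_mul_I_re, mul_assoc]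

lemma integral_exp_mul_fejer_eq {g : ℝ → ℝ} (hg : Measurable g) {C : ℝ} (hC : ∀ t, |g t| ≤ C)
    {G : ℂ → ℂ}
    (hLap : ∀ s : ℂ, 0 < s.re → ∫ t in Ioi (0 : ℝ), (g t : ℂ) * Complex.exp (-(s * t)) = G s)
    {a σ : ℝ} (hσ : 0 < σ) (T : ℝ) :
    ∫ t in Ioi 0, Real.exp (-σ * t) * (g t * fejer (a * (T - t))) =
      (∫ y in Ioc (0 : ℝ) 1, 2 * (1 - (y : ℂ)) * Complex.exp (Complex.I * (y * (a * T))) *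
        G (σ + a * y * Complex.I)).re := by
  let F (t y : ℝ) : ℂ := Real.exp (-σ * t) * g t *
    (2 * (1 - (y : ℂ)) * Complex.exp (Complex.I * (y * (a * (T - t) : ℝ))))
  have hF : Integrable (Function.uncurry F)
      ((volume.restrict (Ioi 0)).prod (volume.restrict (Ioc 0 1))) := by
    have h1 : Integrable (fun t : ℝ ↦ Real.exp (-σ * t)) (volume.restrict (Ioi 0)) :=
      integrableOn_exp_mul_Ioi (by linarith) 0
    have h2 : Integrable (fun y : ℝ ↦ C * ‖2 * (1 - (y : ℂ))‖) (volume.restrict (Ioc 0 1)) :=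
      (Continuous.integrableOn_Icc (by fun_prop)).mono_set Ioc_subset_Icc_self
    refine (h1.mul_prod h2).mono' ?_ ?_
    · have hg' : Measurable fun z : ℝ × ℝ ↦ (g z.1 : ℂ) :=
        Complex.measurable_ofReal.comp (hg.comp measurable_fst)
      exact ((Measurable.mul (by fun_prop) hg').mul (by fun_prop)).aestronglyMeasurable
    · filter_upwards with z
      simp only [Function.uncurry, F, norm_mul, Complex.norm_real, Real.norm_eq_abs, Real.abs_exp]
      rw [mul_comm Complex.I, ← Complex.ofReal_mul, Complex.norm_exp_ofReal_mul_I, mul_one, mul_assoc]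
      gcongr
      exact hC _
  have hswap := integral_integral_swap hF
  have hL : ∫ t in Ioi 0, Real.exp (-σ * t) * (g t * fejer (a * (T - t))) =
      (∫ t in Ioi 0, ∫ y in Ioc (0 : ℝ) 1, F t y).re := by
    have := integral_re hF.integral_prod_left
    simp only [RCLike.re_eq_complex_re] at this
    refine Eq.trans ?_ this
    congr 1 with t
    simp only [Function.uncurry, F]
    rw [integral_const_mul, ← Complex.ofReal_mul, Complex.re_ofReal_mul, ← fejer_eq_re, mul_assoc]
  rw [hL, hswap]
  congr 2 with y
  rw [← hLap _ (by simpa using hσ), ← integral_const_mul]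
  congr 1 with t
  have hE : Complex.exp ((-σ * t : ℝ) : ℂ) * Complex.exp (Complex.I * (y * (a * (T - t) : ℝ))) =
      Complex.exp (Complex.I * (y * (a * T))) *
        Complex.exp (-((σ + a * y * Complex.I) * t)) := by
    rw [← Complex.exp_add, ← Complex.exp_add]
    congr 1
    push_cast
    ring
  simp only [F, Complex.ofReal_exp]
  linear_combination g t * (2 * (1 - (y : ℂ))) * hE

lemma integral_mul_fejer_eq_of_laplace {g : ℝ → ℝ} (hg : Measurable g) {C : ℝ}
    (hC : ∀ t, |g t| ≤ C) {G : ℂ → ℂ} (hG : ContinuousOn G {s | 0 ≤ s.re})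
    (hLap : ∀ s : ℂ, 0 < s.re → ∫ t in Ioi (0 : ℝ), (g t : ℂ) * Complex.exp (-(s * t)) = G s)
    {a : ℝ} (ha : 0 < a) (T : ℝ) :
    ∫ t in Ioi 0, g t * fejer (a * (T - t)) =
      (∫ y in Ioc (0 : ℝ) 1, 2 * (1 - (y : ℂ)) * Complex.exp (Complex.I * (y * (a * T))) *
        G (a * y * Complex.I)).re := by
  have h_int : Integrable (fun t ↦ fejer (a * (T - t))) (volume.restrict (Ioi 0)) :=
    ((integrable_fejer.comp_mul_left' ha.ne').comp_sub_left T).integrableOn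
  have h1 : Tendsto (fun σ : ℝ ↦ ∫ t in Ioi 0, Real.exp (-σ * t) * (g t * fejer (a * (T - t))))
      (𝓝[>] 0) (𝓝 (∫ t in Ioi 0, g t * fejer (a * (T - t)))) := by
    refine tendsto_integral_filter_of_dominated_convergence (fun t ↦ C * fejer (a * (T - t)))
      ?_ ?_ (h_int.const_mul C) ?_
    · filter_upwards with σ
      exact (Measurable.mul (by fun_prop) (hg.mul
        (continuous_fejer.measurable.comp (by fun_prop)))).aestronglyMeasurable
    · filter_upwards [self_mem_nhdsWithin] with σ hσ
      filter_upwards [ae_restrict_mem measurableSet_Ioi] with t ht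
      rw [norm_mul, norm_mul, Real.norm_of_nonneg (fejer_nonneg _), Real.norm_eq_abs, Real.abs_exp,
        ← one_mul (C * _)]
      gcongr
      · exact mul_nonneg (norm_nonneg _) (fejer_nonneg _)
      · exact Real.exp_le_one_iff.mpr (by nlinarith [mem_Ioi.mp ht, mem_Ioi.mp hσ])
      · exact fejer_nonneg _
      · exact hC t
    · filter_upwards with t
      have : ContinuousAt (fun σ : ℝ ↦ Real.exp (-σ * t) * (g t * fejer (a * (T - t)))) 0 := by
        fun_prop
      simpa using this.tendsto.mono_left nhdsWithin_le_nhds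
  have hline : ContinuousOn (fun z : ℝ × ℝ ↦ G (z.1 + a * z.2 * Complex.I))
      (Icc 0 1 ×ˢ Icc 0 1) := by
    refine hG.comp (by fun_prop) fun z hz ↦ ?_
    simpa using hz.1.1
  obtain ⟨M, hM⟩ := (isCompact_Icc.prod isCompact_Icc).exists_bound_of_continuousOn hline
  have h2 : Tendsto (fun σ : ℝ ↦ ∫ y in Ioc (0 : ℝ) 1, 2 * (1 - (y : ℂ)) *
        Complex.exp (Complex.I * (y * (a * T))) * G (σ + a * y * Complex.I)) (𝓝[>] 0)
      (𝓝 (∫ y in Ioc (0 : ℝ) 1, 2 * (1 - (y : ℂ)) * Complex.exp (Complex.I * (y * (a * T))) *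
        G (a * y * Complex.I))) := by
    have hev : ∀ᶠ σ : ℝ in 𝓝[>] 0, σ ∈ Ioc (0 : ℝ) 1 := Ioc_mem_nhdsGT one_pos
    refine tendsto_integral_filter_of_dominated_convergence (fun y ↦ 2 * 1 * 1 * M)
      ?_ ?_ (integrable_const _) ?_
    · filter_upwards [hev] with σ hσ
      refine ContinuousOn.aestronglyMeasurable (ContinuousOn.mul (by fun_prop) ?_) measurableSet_Ioc
      exact hline.comp (f := fun y ↦ (σ, y)) (by fun_prop)
        fun y hy ↦ ⟨Ioc_subset_Icc_self hσ, Ioc_subset_Icc_self hy⟩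
    · filter_upwards [hev] with σ hσ
      filter_upwards [ae_restrict_mem measurableSet_Ioc] with y hy
      rw [norm_mul, norm_mul, norm_mul]
      gcongr
      · simp
      · rw [← Complex.ofReal_one, ← Complex.ofReal_sub, Complex.norm_real, Real.norm_eq_abs, abs_le]
        constructor <;> linarith [hy.1, hy.2]
      · rw [mul_comm Complex.I, ← Complex.ofReal_mul, ← Complex.ofReal_mul,
          Complex.norm_exp_ofReal_mul_I]
      · exact hM (σ, y) ⟨Ioc_subset_Icc_self hσ, Ioc_subset_Icc_self hy⟩
    · filter_upwards [ae_restrict_mem measurableSet_Ioc] with y hy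
      refine Tendsto.const_mul _ ?_
      have h3 := (hline (0, y) ⟨by simp, Ioc_subset_Icc_self hy⟩).tendsto
      simp only [Complex.ofReal_zero, zero_add] at h3
      refine h3.comp (f := fun σ : ℝ ↦ (σ, y)) (tendsto_nhdsWithin_iff.mpr ⟨?_, ?_⟩)
      · exact (Continuous.tendsto' (by fun_prop) _ _ rfl).mono_left nhdsWithin_le_nhds
      · filter_upwards [hev] with σ hσ
        exact ⟨Ioc_subset_Icc_self hσ, Ioc_subset_Icc_self hy⟩
  refine tendsto_nhds_unique h1 ((Complex.continuous_re.continuousAt.tendsto.comp h2).congr' ?_)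
  filter_upwards [self_mem_nhdsWithin] with σ hσ
  exact (integral_exp_mul_fejer_eq hg hC hLap hσ T).symm

/-- If the Laplace transform of a bounded function extends continuously to the closed half-plane,
then the Fejér means of the function vanish at infinity. -/
lemma tendsto_fejer_of_laplace {g : ℝ → ℝ} (hg : Measurable g) (hg0 : ∀ t ≤ 0, g t = 0) {C : ℝ}
    (hC : ∀ t, |g t| ≤ C) {G : ℂ → ℂ} (hG : ContinuousOn G {s | 0 ≤ s.re})
    (hLap : ∀ s : ℂ, 0 < s.re → ∫ t in Ioi (0 : ℝ), (g t : ℂ) * Complex.exp (-(s * t)) = G s)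
    {a : ℝ} (ha : 0 < a) :
    Tendsto (fun T ↦ ∫ u, g (T - u / a) * fejer u) atTop (𝓝 0) := by
  simp_rw [integral_mul_fejer_eq g hg0 ha, integral_mul_fejer_eq_of_laplace hg hC hG hLap ha]
  rw [show 𝓝 (0 : ℝ) = 𝓝 (a * 0) by rw [mul_zero]]
  refine Tendsto.const_mul a ?_
  have hre := Complex.continuous_re.tendsto 0
  rw [Complex.zero_re] at hre
  refine hre.comp ?_
  have hRL := Real.tendsto_integral_exp_smul_cocompact
    ((Ioc (0 : ℝ) 1).indicator fun y ↦ 2 * (1 - (y : ℂ)) * G (a * y * Complex.I))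
  have hw : Tendsto (fun T : ℝ ↦ -(a * T / (2 * Real.pi))) atTop (cocompact ℝ) := by
    refine (tendsto_neg_atTop_atBot.comp ?_).mono_right atBot_le_cocompact
    exact (tendsto_id.const_mul_atTop ha).atTop_div_const (by positivity)
  refine (hRL.comp hw).congr fun T ↦ ?_
  rw [Function.comp_apply, ← integral_indicator measurableSet_Ioc]
  congr 1 with y
  by_cases hy : y ∈ Ioc (0 : ℝ) 1
  · simp only [indicator_of_mem hy, Circle.smul_def, Real.fourierChar_apply, smul_eq_mul]
    have hE : ((2 * Real.pi * -(y * -(a * T / (2 * Real.pi))) : ℝ) : ℂ) * Complex.I =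
        Complex.I * (y * (a * T)) := by
      push_cast
      field
    rw [hE]
    ring
  · simp [indicator_of_notMem hy]

lemma psi_exp_nonneg_le (t : ℝ) : 0 ≤ ψ (Real.exp t) * Real.exp (-t) ∧
    ψ (Real.exp t) * Real.exp (-t) ≤ Real.log 4 + 4 := by
  refine ⟨mul_nonneg (psi_nonneg _) (Real.exp_pos _).le, ?_⟩
  rw [Real.exp_neg, ← div_eq_mul_inv, div_le_iff₀ (Real.exp_pos _)]
  exact psi_le_const_mul_self (Real.exp_pos t).le

lemma LSeries_vonMangoldt_eq_integral_exp {s : ℂ} (hs : 1 < s.re) :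
    LSeries (fun n ↦ (vonMangoldt n : ℂ)) s =
      s * ∫ t in Ioi (0 : ℝ), (ψ (Real.exp t) : ℂ) * Complex.exp (-(s * t)) := by
  rw [LSeries_eq_mul_integral_of_nonneg (fun n ↦ vonMangoldt n) (r := 1) zero_le_one hs ?_
    (fun _ ↦ vonMangoldt_nonneg), ← Real.exp_zero, ← integral_comp_exp_Ioi]
  · congr 2 with t
    have h1 : (∑ k ∈ Finset.Icc 1 ⌊Real.exp t⌋₊, (vonMangoldt k : ℂ)) = ψ (Real.exp t) := by
      rw [psi, ← Complex.ofReal_sum]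
      rfl
    rw [h1, Complex.real_smul, Complex.ofReal_exp, ← Complex.ofReal_exp,
      Complex.cpow_def_of_ne_zero (by exact_mod_cast (Real.exp_pos t).ne'),
      ← Complex.ofReal_log (Real.exp_pos t).le, Real.log_exp, mul_left_comm, Complex.ofReal_exp,
      ← Complex.exp_add]
    congr 2
    ring
  · simp only [Real.rpow_one]
    refine Asymptotics.IsBigO.of_bound (Real.log 4 + 4) (Eventually.of_forall fun n ↦ ?_)
    have h := psi_le_const_mul_self (x := n) (by positivity)
    rw [psi, Nat.floor_natCast] at h
    rw [Real.norm_of_nonneg (Finset.sum_nonneg fun _ _ ↦ vonMangoldt_nonneg), Real.norm_natCast]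
    exact h

lemma LSeries_vonMangoldt_eq_aux {s : ℂ} (hs : 1 < s.re) :
    LSeries (fun n ↦ (vonMangoldt n : ℂ)) s =
      vonMangoldt.LFunctionResidueClassAux (1 : ZMod 1) s + 1 / (s - 1) := by
  have h := vonMangoldt.eqOn_LFunctionResidueClassAux (a := (1 : ZMod 1)) isUnit_one hs
  have hΛ : vonMangoldt.residueClass (1 : ZMod 1) = fun n ↦ vonMangoldt n := by
    ext n
    exact indicator_of_mem (s := {n : ℕ | (n : ZMod 1) = 1}) (Subsingleton.elim _ _) _
  rw [h, hΛ]
  simp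

lemma laplace_psi {s : ℂ} (hs : 0 < s.re) :
    ∫ t in Ioi (0 : ℝ), ((ψ (Real.exp t) * Real.exp (-t) - 1 : ℝ) : ℂ) * Complex.exp (-(s * t)) =
      (vonMangoldt.LFunctionResidueClassAux (1 : ZMod 1) (s + 1) - 1) / (s + 1) := by
  have hs1 : 1 < (s + 1).re := by simpa using hs
  have hne : s ≠ 0 := fun h ↦ by simp [h] at hs
  have hne1 : s + 1 ≠ 0 := fun h ↦ by
    rw [h] at hs1
    simp at hs1
    linarith
  have hE : IntegrableOn (fun t : ℝ ↦ Complex.exp (-s * t)) (Ioi 0) :=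
    integrableOn_exp_mul_complex_Ioi (by simpa using hs) 0
  have hP : Integrable (fun t : ℝ ↦ ((ψ (Real.exp t) * Real.exp (-t) : ℝ) : ℂ) *
      Complex.exp (-s * t)) (volume.restrict (Ioi 0)) := by
    refine hE.bdd_mul (c := Real.log 4 + 4) ?_ ?_
    · exact (Complex.measurable_ofReal.comp ((psi_mono.measurable.comp Real.measurable_exp).mul
        (by fun_prop))).aestronglyMeasurable
    · filter_upwards with t
      rw [Complex.norm_real, Real.norm_of_nonneg (psi_exp_nonneg_le t).1]
      exact (psi_exp_nonneg_le t).2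
  have h1 := LSeries_vonMangoldt_eq_integral_exp hs1
  rw [LSeries_vonMangoldt_eq_aux hs1, add_sub_cancel_right] at h1
  have h2 : ∫ t in Ioi (0 : ℝ), ((ψ (Real.exp t) * Real.exp (-t) : ℝ) : ℂ) * Complex.exp (-s * t) =
      ∫ t in Ioi (0 : ℝ), (ψ (Real.exp t) : ℂ) * Complex.exp (-((s + 1) * t)) := by
    congr 1 with t
    rw [Complex.ofReal_mul, Complex.ofReal_exp, mul_assoc, ← Complex.exp_add]
    congr 2
    push_cast
    ring
  have h3 : ∫ t in Ioi (0 : ℝ), Complex.exp (-s * t) = 1 / s := by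
    rw [integral_exp_mul_complex_Ioi (by simpa using hs)]
    simp
  have h4 : ∫ t in Ioi (0 : ℝ), ((ψ (Real.exp t) * Real.exp (-t) - 1 : ℝ) : ℂ) *
      Complex.exp (-(s * t)) = (∫ t in Ioi (0 : ℝ), ((ψ (Real.exp t) * Real.exp (-t) : ℝ) : ℂ) *
      Complex.exp (-s * t)) - ∫ t in Ioi (0 : ℝ), Complex.exp (-s * t) := by
    rw [← integral_sub hP hE]
    congr 1 with t
    rw [neg_mul]
    push_cast
    ring
  rw [h4, h2, h3, ← mul_right_inj' hne1, mul_sub, ← h1]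
  field

/-- The **prime number theorem** for the second Chebyshev function. -/
theorem tendsto_psi_div_id : Tendsto (fun x ↦ ψ x / x) atTop (𝓝 1) := by
  let g (t : ℝ) : ℝ := if 0 < t then ψ (Real.exp t) * Real.exp (-t) - 1 else 0
  have hpos {t : ℝ} (ht : 0 < t) : g t = ψ (Real.exp t) * Real.exp (-t) - 1 := if_pos ht
  have hg0 : ∀ t ≤ 0, g t = 0 := fun t ht ↦ if_neg ht.not_gt
  have hg : Measurable g := Measurable.ite measurableSet_Ioi
    (((psi_mono.measurable.comp Real.measurable_exp).mul (by fun_prop)).sub_const 1)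
    measurable_const
  have hlog : 0 ≤ Real.log 4 := Real.log_nonneg (by norm_num)
  have hC (t) : |g t| ≤ Real.log 4 + 4 := by
    rcases lt_or_ge 0 t with ht | ht
    · have := psi_exp_nonneg_le t
      rw [hpos ht, abs_le]
      constructor <;> linarith
    · rw [hg0 t ht, abs_zero]
      positivity
  have hG : ContinuousOn (fun s : ℂ ↦ (vonMangoldt.LFunctionResidueClassAux (1 : ZMod 1) (s + 1) - 1)
      / (s + 1)) {s | 0 ≤ s.re} := by
    refine ContinuousOn.div (ContinuousOn.sub ?_ continuousOn_const) (by fun_prop) fun s hs h ↦ ?_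
    · refine (vonMangoldt.continuousOn_LFunctionResidueClassAux (1 : ZMod 1)).comp (by fun_prop)
        fun s hs ↦ ?_
      simpa using hs
    · have := congrArg Complex.re h
      simp at this
      linarith [mem_ofPred_eq.mp hs]
  have hLap (s : ℂ) (hs : 0 < s.re) : ∫ t in Ioi (0 : ℝ), (g t : ℂ) * Complex.exp (-(s * t)) =
      (vonMangoldt.LFunctionResidueClassAux (1 : ZMod 1) (s + 1) - 1) / (s + 1) := by
    rw [← laplace_psi hs]
    refine setIntegral_congr_fun measurableSet_Ioi fun t ht ↦ ?_
    simp only [hpos ht]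
  have hlim : Tendsto g atTop (𝓝 0) := by
    refine tendsto_zero_of_tendsto_fejer hg hC
      (fun a ha ↦ tendsto_fejer_of_laplace hg hg0 hC hG hLap ha) fun s t hs hst ↦ ?_
    rw [hpos hs, hpos (hs.trans_le hst), sub_add_cancel, sub_add_cancel, mul_assoc, ← Real.exp_add]
    rw [show -s + -(t - s) = -t by ring]
    exact mul_le_mul_of_nonneg_right (psi_mono (Real.exp_le_exp.mpr hst)) (Real.exp_pos _).le
  have h1 := (hlim.comp Real.tendsto_log_atTop).add_const 1
  rw [zero_add] at h1
  refine h1.congr' ?_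
  filter_upwards [eventually_gt_atTop 1] with x hx
  rw [Function.comp_apply, hpos (Real.log_pos hx), Real.exp_neg, Real.exp_log (by linarith)]
  ring

theorem tendsto_theta_div_id : Tendsto (fun x ↦ θ x / x) atTop (𝓝 1) := by
  have h : Tendsto (fun x : ℝ ↦ (ψ - θ) x / x) atTop (𝓝 0) := by
    refine (isBigO_psi_sub_theta_sqrt.trans_isLittleO ?_).tendsto_div_nhds_zero
    refine Asymptotics.isLittleO_of_tendsto' ?_ ?_
    · filter_upwards [eventually_gt_atTop 0] with x hx h0
      exact absurd h0 hx.ne'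
    · refine Tendsto.congr' ?_ Real.tendsto_sqrt_atTop.inv_tendsto_atTop
      filter_upwards [eventually_gt_atTop 0] with x hx
      rw [Pi.inv_apply, Real.sqrt_div_self]
  have h2 := tendsto_psi_div_id.sub h
  rw [sub_zero] at h2
  refine h2.congr fun x ↦ ?_
  simp [sub_div]

/-- The **prime number theorem** for the prime counting function. -/
theorem tendsto_primeCounting_mul_log_div_id :
    Tendsto (fun x : ℝ ↦ Nat.primeCounting ⌊x⌋₊ * Real.log x / x) atTop (𝓝 1) := by
  have h : Tendsto (fun x : ℝ ↦ (Nat.primeCounting ⌊x⌋₊ - θ x / Real.log x) / (x / Real.log x))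
      atTop (𝓝 0) := by
    refine (primeCounting_sub_theta_div_log_isBigO.trans_isLittleO ?_).tendsto_div_nhds_zero
    refine Asymptotics.isLittleO_of_tendsto' ?_ ?_
    · filter_upwards [eventually_gt_atTop 1] with x hx h0
      have := Real.log_pos hx
      have : x / Real.log x ≠ 0 := by positivity
      contradiction
    · refine Tendsto.congr' ?_ Real.tendsto_log_atTop.inv_tendsto_atTop
      filter_upwards [eventually_gt_atTop 1] with x hx
      have := Real.log_pos hx
      simp only [Pi.inv_apply]
      field
  have h2 := h.add tendsto_theta_div_id
  rw [zero_add] at h2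
  refine h2.congr' ?_
  filter_upwards [eventually_gt_atTop 1] with x hx
  have := Real.log_pos hx
  field

lemma sum_log_eq_sum_vonMangoldt_mul_div (n : ℕ) :
    Real.log n.factorial = ∑ d ∈ Finset.Ioc 0 n, vonMangoldt d * (n / d : ℕ) := by
  rw [← sum_Ioc_mul_zeta_eq_sum, vonMangoldt_mul_zeta]
  induction n with
  | zero => simp
  | succ n ih =>
    rw [Finset.sum_Ioc_succ_top (Nat.zero_le _), ← ih, Nat.factorial_succ, Nat.cast_mul,
      Real.log_mul (by positivity) (by positivity), add_comm]
    rfl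

lemma sum_Icc_zero_vonMangoldt_div (n : ℕ) :
    ∑ k ∈ Finset.Icc 0 n, vonMangoldt k / k = ∑ k ∈ Finset.Ioc 0 n, vonMangoldt k / k := by
  rw [Finset.Icc_eq_cons_Ioc (Nat.zero_le _), Finset.sum_cons]
  simp

lemma abs_sum_vonMangoldt_div_sub_log_le {n : ℕ} (hn : n ≠ 0) :
    |∑ k ∈ Finset.Icc 0 n, vonMangoldt k / k - Real.log n| ≤ Real.log 4 + 4 := by
  rw [sum_Icc_zero_vonMangoldt_div]
  have hn0 : (0 : ℝ) < n := by positivity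
  have h4 : 0 ≤ Real.log 4 := Real.log_nonneg (by norm_num)
  have hfac := sum_log_eq_sum_vonMangoldt_mul_div n
  have hup : Real.log n.factorial ≤ n * Real.log n := by
    rw [← Real.log_pow]
    exact Real.log_le_log (by positivity) (by exact_mod_cast Nat.factorial_le_pow n)
  have hlow : n * Real.log n - n ≤ Real.log n.factorial := by
    have := Stirling.le_log_factorial_stirling hn
    have h1 : 0 ≤ Real.log n := Real.log_natCast_nonneg n
    have h2 : 0 ≤ Real.log (2 * Real.pi) := Real.log_nonneg (by linarith [Real.pi_gt_three])
    linarith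
  have hψ : ψ n ≤ (Real.log 4 + 4) * n := psi_le_const_mul_self hn0.le
  rw [psi, Nat.floor_natCast] at hψ
  have h1 : Real.log n.factorial ≤ n * ∑ k ∈ Finset.Ioc 0 n, vonMangoldt k / k := by
    rw [hfac, Finset.mul_sum]
    refine Finset.sum_le_sum fun k _ ↦ ?_
    rw [mul_div_left_comm]
    exact mul_le_mul_of_nonneg_left Nat.cast_div_le vonMangoldt_nonneg
  have h2 : n * ∑ k ∈ Finset.Ioc 0 n, vonMangoldt k / k ≤
      Real.log n.factorial + ∑ k ∈ Finset.Ioc 0 n, vonMangoldt k := by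
    rw [hfac, Finset.mul_sum, ← Finset.sum_add_distrib]
    refine Finset.sum_le_sum fun k hk ↦ ?_
    rw [mul_div_left_comm, ← mul_add_one]
    refine mul_le_mul_of_nonneg_left ?_ vonMangoldt_nonneg
    have hk0 : (0 : ℝ) < k := by exact_mod_cast (Finset.mem_Ioc.mp hk).1
    rw [div_le_iff₀ hk0]
    rw [mul_comm]
    exact_mod_cast (Nat.lt_mul_div_succ n (Finset.mem_Ioc.mp hk).1).le
  rw [abs_le]
  constructor
  · have : n * (Real.log n - 1) ≤ n * ∑ k ∈ Finset.Ioc 0 n, vonMangoldt k / k := by linarith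
    linarith [le_of_mul_le_mul_left this hn0]
  · have : n * ∑ k ∈ Finset.Ioc 0 n, vonMangoldt k / k ≤ n * (Real.log n + (Real.log 4 + 4)) := by
      linarith
    linarith [le_of_mul_le_mul_left this hn0]

lemma abs_sum_floor_vonMangoldt_div_sub_log_le {t : ℝ} (ht : 1 ≤ t) :
    |∑ k ∈ Finset.Icc 0 ⌊t⌋₊, vonMangoldt k / k - Real.log t| ≤ Real.log 4 + 5 := by
  have hn : ⌊t⌋₊ ≠ 0 := (Nat.floor_pos.mpr ht).ne'
  have hn1 : (1 : ℝ) ≤ ⌊t⌋₊ := by exact_mod_cast Nat.floor_pos.mpr ht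
  have h1 := abs_le.mp (abs_sum_vonMangoldt_div_sub_log_le hn)
  have h2 : Real.log ⌊t⌋₊ ≤ Real.log t :=
    Real.log_le_log (by linarith) (Nat.floor_le (by linarith))
  have h3 : Real.log t ≤ Real.log ⌊t⌋₊ + 1 := by
    have h4 : Real.log (t / ⌊t⌋₊) ≤ t / ⌊t⌋₊ - 1 := Real.log_le_sub_one_of_pos (by positivity)
    rw [Real.log_div (by positivity) (by positivity)] at h4
    have h5 : t / ⌊t⌋₊ ≤ 2 := by
      rw [div_le_iff₀ (by positivity)]
      linarith [Nat.lt_floor_add_one t]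
    linarith
  rw [abs_le]
  constructor <;> linarith

lemma sum_vonMangoldt_div_mul_log_eq {b : ℝ} (hb : 2 ≤ b) :
    ∑ k ∈ Finset.Icc 0 ⌊b⌋₊, vonMangoldt k / (k * Real.log k) - Real.log (Real.log b) =
      1 - Real.log (Real.log 2) +
        (∑ k ∈ Finset.Icc 0 ⌊b⌋₊, vonMangoldt k / k - Real.log b) * (Real.log b)⁻¹ +
        ∫ t in (2)..b, t⁻¹ / Real.log t ^ 2 *
          (∑ k ∈ Finset.Icc 0 ⌊t⌋₊, vonMangoldt k / k - Real.log t) := by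
  have hlog {t : ℝ} (ht : t ∈ Icc 2 b) : 0 < Real.log t := Real.log_pos (by linarith [ht.1])
  have hderiv {t : ℝ} (ht : t ∈ Icc 2 b) :
      HasDerivAt (fun t ↦ (Real.log t)⁻¹) (-(t⁻¹ / Real.log t ^ 2)) t := by
    have := (Real.hasDerivAt_log (x := t) (by linarith [ht.1])).inv (hlog ht).ne'
    rwa [neg_div] at this
  have h_int : IntegrableOn (fun t ↦ t⁻¹ / Real.log t ^ 2) (Icc 2 b) :=
    (integrableOn_inv_div_log_sq_Ioi (c := 3 / 2) (by norm_num)).mono_set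
      fun t ht ↦ by simp only [mem_Ioi]; linarith [ht.1]
  have h := sum_mul_eq_sub_integral_mul₁ (fun k ↦ vonMangoldt k / k) (f := fun t ↦ (Real.log t)⁻¹)
    (by simp) (by simp) b (fun t ht ↦ (hderiv ht).differentiableAt)
    (h_int.neg.congr_fun (fun t ht ↦ (hderiv ht).deriv.symm) measurableSet_Icc)
  have h0 : ∑ k ∈ Finset.Icc 0 ⌊b⌋₊, vonMangoldt k / (k * Real.log k) =
      ∑ k ∈ Finset.Icc 0 ⌊b⌋₊, (Real.log k)⁻¹ * (vonMangoldt k / k) :=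
    Finset.sum_congr rfl fun k _ ↦ by rw [mul_comm (k : ℝ), ← div_div, div_right_comm]; ring
  have h1 : ∫ t in Ioc 2 b, deriv (fun t ↦ (Real.log t)⁻¹) t *
        ∑ k ∈ Finset.Icc 0 ⌊t⌋₊, vonMangoldt k / k =
      - ∫ t in Ioc 2 b, t⁻¹ / Real.log t ^ 2 * ∑ k ∈ Finset.Icc 0 ⌊t⌋₊, vonMangoldt k / k := by
    rw [← integral_neg]
    refine setIntegral_congr_fun measurableSet_Ioc fun t ht ↦ ?_
    simp only [(hderiv (Ioc_subset_Icc_self ht)).deriv, neg_mul]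
  have h_int2 : IntegrableOn (fun t ↦ t⁻¹ / Real.log t ^ 2 *
      ∑ k ∈ Finset.Icc 0 ⌊t⌋₊, vonMangoldt k / k) (Icc 2 b) :=
    integrableOn_mul_sum_Icc _ zero_le_two h_int
  have hderiv2 {t : ℝ} (ht : t ∈ uIcc 2 b) :
      HasDerivAt (fun t ↦ Real.log (Real.log t)) (t⁻¹ / Real.log t ^ 2 * Real.log t) t := by
    rw [uIcc_of_le hb] at ht
    convert (Real.hasDerivAt_log (x := t) (by linarith [ht.1])).log (hlog ht).ne' using 1
    have := hlog ht
    field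
  have h_int3 : IntervalIntegrable (fun t ↦ t⁻¹ / Real.log t ^ 2 * Real.log t) volume 2 b := by
    refine ContinuousOn.intervalIntegrable fun t ht ↦ ContinuousAt.continuousWithinAt ?_
    rw [uIcc_of_le hb] at ht
    have : t ≠ 0 := by linarith [ht.1]
    have := (hlog ht).ne'
    fun_prop (disch := first | assumption | positivity)
  have h2 := intervalIntegral.integral_eq_sub_of_hasDerivAt (fun t ht ↦ hderiv2 ht) h_int3
  have h_int2' : IntervalIntegrable (fun t ↦ t⁻¹ / Real.log t ^ 2 *
      ∑ k ∈ Finset.Icc 0 ⌊t⌋₊, vonMangoldt k / k) volume 2 b :=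
    (intervalIntegrable_iff_integrableOn_Icc_of_le hb).mpr h_int2
  simp_rw [mul_sub]
  rw [intervalIntegral.integral_sub h_int2' h_int3, h2, h0, h, h1,
    ← intervalIntegral.integral_of_le hb]
  have := (hlog ⟨hb, le_rfl⟩).ne'
  field_simp
  ring

lemma exists_tendsto_sum_vonMangoldt_div_mul_log_sub_log_log :
    ∃ C, Tendsto (fun b : ℝ ↦ ∑ k ∈ Finset.Icc 0 ⌊b⌋₊, vonMangoldt k / (k * Real.log k) -
      Real.log (Real.log b)) atTop (𝓝 C) := by
  have h_int : IntegrableOn (fun t ↦ t⁻¹ / Real.log t ^ 2 *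
      (∑ k ∈ Finset.Icc 0 ⌊t⌋₊, vonMangoldt k / k - Real.log t)) (Ioi 2) := by
    refine (integrableOn_inv_div_log_sq_Ioi (c := 2) (by norm_num)).mul_bdd
      (c := Real.log 4 + 5) ?_ ?_
    · have : Measurable fun t : ℝ ↦ ∑ k ∈ Finset.Icc 0 ⌊t⌋₊, vonMangoldt k / k :=
        (measurable_from_nat (f := fun n ↦ ∑ k ∈ Finset.Icc 0 n, vonMangoldt k / k)).comp
          Nat.measurable_floor
      exact (this.sub Real.measurable_log).aestronglyMeasurable
    · filter_upwards [ae_restrict_mem measurableSet_Ioi] with t ht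
      exact abs_sum_floor_vonMangoldt_div_sub_log_le (one_le_two.trans (mem_Ioi.mp ht).le)
  have h1 := intervalIntegral_tendsto_integral_Ioi 2 h_int tendsto_id
  have h2 : Tendsto (fun b : ℝ ↦ (∑ k ∈ Finset.Icc 0 ⌊b⌋₊, vonMangoldt k / k - Real.log b) *
      (Real.log b)⁻¹) atTop (𝓝 0) := by
    refine isBoundedUnder_le_mul_tendsto_zero ?_ Real.tendsto_log_atTop.inv_tendsto_atTop
    refine isBoundedUnder_of_eventually_le (a := Real.log 4 + 5) ?_
    filter_upwards [eventually_ge_atTop 1] with b hb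
    exact abs_sum_floor_vonMangoldt_div_sub_log_le hb
  refine ⟨_, (((tendsto_const_nhds (x := 1 - Real.log (Real.log 2))).add h2).add h1).congr' ?_⟩
  filter_upwards [eventually_ge_atTop 2] with b hb
  exact (sum_vonMangoldt_div_mul_log_eq hb).symm

lemma integrableOn_exp_neg_mul_abs_log :
    IntegrableOn (fun v ↦ Real.exp (-v) * |Real.log v|) (Ioi 0) := by
  have h1 := Real.GammaIntegral_convergent (s := 2) two_pos
  have h2 := (Real.GammaIntegral_convergent (s := 1 / 2) (by norm_num)).const_mul 2
  refine (h1.add h2).mono' (by fun_prop) ?_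
  filter_upwards [ae_restrict_mem measurableSet_Ioi] with v hv
  have hv0 : (0 : ℝ) < v := hv
  have h3 : Real.log v ≤ v := (Real.log_le_sub_one_of_pos hv0).trans (by linarith)
  have h4 : -Real.log v ≤ 2 * v ^ (-(1 / 2) : ℝ) := by
    have := Real.log_le_sub_one_of_pos (Real.rpow_pos_of_pos hv0 (-(1 / 2)))
    rw [Real.log_rpow hv0] at this
    linarith
  have h5 : 0 < v ^ (-(1 / 2) : ℝ) := Real.rpow_pos_of_pos hv0 _
  rw [Real.norm_of_nonneg (by positivity), Pi.add_apply, show (2 - 1 : ℝ) = 1 by norm_num,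
    Real.rpow_one, show (1 / 2 - 1 : ℝ) = -(1 / 2) by norm_num, mul_left_comm, ← mul_add]
  refine mul_le_mul_of_nonneg_left (abs_le'.mpr ⟨?_, ?_⟩) (Real.exp_pos _).le <;> linarith

lemma integrableOn_exp_neg_mul_log :
    IntegrableOn (fun v ↦ Real.exp (-v) * Real.log v) (Ioi 0) := by
  refine integrableOn_exp_neg_mul_abs_log.mono' (by fun_prop) (Eventually.of_forall fun v ↦ ?_)
  rw [norm_mul, Real.norm_of_nonneg (Real.exp_pos _).le, Real.norm_eq_abs]

lemma integral_exp_neg_mul_log :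
    ∫ v in Ioi 0, Real.exp (-v) * Real.log v = -Real.eulerMascheroniConstant := by
  have h := Complex.hasDerivAt_GammaIntegral (s := 1) (by simp)
  have h2 : HasDerivAt Complex.GammaIntegral (-Real.eulerMascheroniConstant : ℂ) 1 := by
    refine Complex.hasDerivAt_Gamma_one.congr_of_eventuallyEq ?_
    filter_upwards [(isOpen_lt continuous_const Complex.continuous_re).mem_nhds
      (show (0 : ℝ) < (1 : ℂ).re by simp)] with s hs
    exact (Complex.Gamma_eq_integral hs).symm
  have h3 := h.unique h2
  simp only [sub_self, Complex.cpow_zero, one_mul] at h3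
  have h4 : (∫ v in Ioi 0, ((Real.exp (-v) * Real.log v : ℝ) : ℂ)) =
      -Real.eulerMascheroniConstant := by
    rw [← h3]
    congr 1 with v
    push_cast
    ring
  rw [integral_complex_ofReal] at h4
  exact_mod_cast h4

section LogLogSums

variable {a : ℕ → ℝ} {C : ℝ}

lemma isBigO_sum_rpow_of_tendsto_sub_log_log (h0 : a 0 = 0)
    (hC : Tendsto (fun b : ℝ ↦ ∑ k ∈ Finset.Icc 0 ⌊b⌋₊, a k - Real.log (Real.log b)) atTop (𝓝 C))
    {r : ℝ} (hr : 0 < r) :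
    (fun n ↦ ∑ k ∈ Finset.Icc 1 n, a k) =O[atTop] fun n : ℕ ↦ (n : ℝ) ^ r := by
  have h1 : (fun b : ℝ ↦ Real.log (Real.log b)) =O[atTop] fun b : ℝ ↦ b ^ r :=
    ((Real.isLittleO_log_id_atTop.comp_tendsto Real.tendsto_log_atTop).trans
      (isLittleO_log_rpow_atTop hr)).isBigO
  have h2 : (fun _ : ℝ ↦ (1 : ℝ)) =O[atTop] fun b : ℝ ↦ b ^ r :=
    ((Asymptotics.isLittleO_const_left_of_ne one_ne_zero).mpr
      (tendsto_norm_atTop_atTop.comp (tendsto_rpow_atTop hr))).isBigO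
  have h3 := ((hC.isBigO_one ℝ).trans h2).add h1
  refine (h3.comp_tendsto tendsto_natCast_atTop_atTop).congr_left fun n ↦ ?_
  simp only [Function.comp_apply, Nat.floor_natCast, sub_add_cancel]
  rw [Finset.Icc_eq_cons_Ioc (Nat.zero_le _), Finset.sum_cons, h0, zero_add]
  rfl

lemma tsum_mul_rpow_eq_integral (h0 : a 0 = 0) (ha : ∀ n, 0 ≤ a n)
    (hC : Tendsto (fun b : ℝ ↦ ∑ k ∈ Finset.Icc 0 ⌊b⌋₊, a k - Real.log (Real.log b)) atTop (𝓝 C))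
    {ε : ℝ} (hε : 0 < ε) :
    ∑' n : ℕ, a n * (n : ℝ) ^ (-ε) =
      ∫ v in Ioi 0, Real.exp (-v) * ∑ k ∈ Finset.Icc 0 ⌊Real.exp (v / ε)⌋₊, a k := by
  have h := LSeries_eq_mul_integral_of_nonneg a (r := ε / 2) (by positivity) (s := ε)
    (by rw [Complex.ofReal_re]; linarith)
    (isBigO_sum_rpow_of_tendsto_sub_log_log h0 hC (by positivity)) ha
  have h1 : LSeries (fun n ↦ (a n : ℂ)) ε = ((∑' n : ℕ, a n * (n : ℝ) ^ (-ε) : ℝ) : ℂ) := by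
    rw [LSeries_def₀ (by simp [h0]), Complex.ofReal_tsum]
    congr 1 with n
    rw [Complex.ofReal_mul, Complex.ofReal_cpow (by positivity), Complex.ofReal_neg,
      Complex.ofReal_natCast, Complex.cpow_neg, div_eq_mul_inv]
  have h2 : ∫ t in Ioi (1 : ℝ), (∑ k ∈ Finset.Icc 1 ⌊t⌋₊, (a k : ℂ)) * (t : ℂ) ^ (-((ε : ℂ) + 1)) =
      ((∫ t in Ioi (1 : ℝ), (∑ k ∈ Finset.Icc 0 ⌊t⌋₊, a k) * t ^ (-(ε + 1)) : ℝ) : ℂ) := by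
    rw [← integral_complex_ofReal]
    refine setIntegral_congr_fun measurableSet_Ioi fun t ht ↦ ?_
    have ht0 : (0 : ℝ) < t := one_pos.trans ht
    rw [Complex.ofReal_mul, Complex.ofReal_cpow ht0.le, Finset.Icc_eq_cons_Ioc (Nat.zero_le _),
      Finset.sum_cons, h0, zero_add]
    push_cast
    rfl
  rw [h1, h2] at h
  have h3 : ∑' n : ℕ, a n * (n : ℝ) ^ (-ε) =
      ε * ∫ t in Ioi (1 : ℝ), (∑ k ∈ Finset.Icc 0 ⌊t⌋₊, a k) * t ^ (-(ε + 1)) := by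
    exact_mod_cast h
  have h4 := integral_comp_exp_Ioi
    (fun t ↦ (∑ k ∈ Finset.Icc 0 ⌊t⌋₊, a k) * t ^ (-(ε + 1))) 0
  have h5 := integral_comp_mul_left_Ioi' (fun u ↦ Real.exp u •
    ((∑ k ∈ Finset.Icc 0 ⌊Real.exp u⌋₊, a k) * Real.exp u ^ (-(ε + 1)))) 0 (inv_pos.mpr hε)
  rw [Real.exp_zero] at h4
  rw [mul_zero] at h5
  rw [h3, ← h4, ← h5, smul_eq_mul, mul_inv_cancel_left₀ hε.ne']
  refine setIntegral_congr_fun measurableSet_Ioi fun v _ ↦ ?_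
  simp only [smul_eq_mul]
  rw [← Real.exp_mul, mul_left_comm, ← Real.exp_add, mul_comm, div_eq_inv_mul]
  congr 2
  field

lemma exists_abs_sub_log_le (ha : ∀ n, 0 ≤ a n)
    (hC : Tendsto (fun b : ℝ ↦ ∑ k ∈ Finset.Icc 0 ⌊b⌋₊, a k - Real.log (Real.log b)) atTop (𝓝 C)) :
    ∃ M, 0 ≤ M ∧ ∀ u > 0, |∑ k ∈ Finset.Icc 0 ⌊Real.exp u⌋₊, a k - Real.log u| ≤
      M + if u < 1 then |Real.log u| else 0 := by
  have hmono : Monotone fun u : ℝ ↦ ∑ k ∈ Finset.Icc 0 ⌊Real.exp u⌋₊, a k := fun u v huv ↦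
    Finset.sum_le_sum_of_subset_of_nonneg (Finset.Icc_subset_Icc_right
      (Nat.floor_le_floor (Real.exp_le_exp.mpr huv))) fun _ _ _ ↦ ha _
  have hpos (u : ℝ) : 0 ≤ ∑ k ∈ Finset.Icc 0 ⌊Real.exp u⌋₊, a k := Finset.sum_nonneg fun _ _ ↦ ha _
  have h1 := (hC.comp Real.tendsto_exp_atTop).abs.eventually_le_const (lt_add_one |C|)
  obtain ⟨U, hU⟩ := eventually_atTop.mp h1
  simp only [Function.comp_apply, Real.log_exp] at hU
  set V := max U 1
  have hV : 0 ≤ Real.log V := Real.log_nonneg (le_max_right _ _)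
  refine ⟨|C| + 1 + ∑ k ∈ Finset.Icc 0 ⌊Real.exp V⌋₊, a k + Real.log V,
    by have := hpos V; positivity, fun u hu ↦ ?_⟩
  have hC0 := abs_nonneg C
  have hV0 := hpos V
  have hu0 := hpos u
  split_ifs with hu1
  · have h2 := hmono (hu1.le.trans (le_max_right U 1))
    refine (abs_sub _ _).trans ?_
    rw [abs_of_nonneg (hpos u)]
    simp only at h2
    linarith
  · rcases le_total U u with h | h
    · linarith [hU u h]
    · have h2 := hmono (h.trans (le_max_left U 1))
      have h3 : Real.log u ≤ Real.log V := Real.log_le_log hu (h.trans (le_max_left U 1))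
      have h4 : 0 ≤ Real.log u := Real.log_nonneg (not_lt.mp hu1)
      simp only at h2
      rw [abs_le]
      constructor <;> linarith

theorem tendsto_tsum_mul_rpow_add_log (h0 : a 0 = 0) (ha : ∀ n, 0 ≤ a n)
    (hC : Tendsto (fun b : ℝ ↦ ∑ k ∈ Finset.Icc 0 ⌊b⌋₊, a k - Real.log (Real.log b)) atTop (𝓝 C)) :
    Tendsto (fun ε : ℝ ↦ ∑' n : ℕ, a n * (n : ℝ) ^ (-ε) + Real.log ε) (𝓝[>] 0)
      (𝓝 (C - Real.eulerMascheroniConstant)) := by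
  obtain ⟨M, hM0, hM⟩ := exists_abs_sub_log_le ha hC
  have hexp : IntegrableOn (fun v : ℝ ↦ Real.exp (-v)) (Ioi 0) := integrableOn_exp_neg_Ioi 0
  have hmeas (ε : ℝ) : Measurable fun v : ℝ ↦ ∑ k ∈ Finset.Icc 0 ⌊Real.exp (v / ε)⌋₊, a k :=
    (measurable_from_nat (f := fun n ↦ ∑ k ∈ Finset.Icc 0 n, a k)).comp
      (Nat.measurable_floor.comp (by fun_prop))
  have hbd : IntegrableOn (fun v ↦ M * Real.exp (-v) + Real.exp (-v) * |Real.log v|) (Ioi 0) :=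
    (hexp.const_mul M).add integrableOn_exp_neg_mul_abs_log
  have hle {ε : ℝ} (hε : ε ∈ Ioo 0 1) {v : ℝ} (hv : v ∈ Ioi 0) :
      ‖Real.exp (-v) * (∑ k ∈ Finset.Icc 0 ⌊Real.exp (v / ε)⌋₊, a k - Real.log (v / ε))‖ ≤
        M * Real.exp (-v) + Real.exp (-v) * |Real.log v| := by
    have hv0 : 0 < v := hv
    have h1 := hM (v / ε) (div_pos hv0 hε.1)
    rw [norm_mul, Real.norm_of_nonneg (Real.exp_pos _).le, Real.norm_eq_abs, mul_comm M, ← mul_add]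
    refine mul_le_mul_of_nonneg_left (h1.trans ?_) (Real.exp_pos _).le
    gcongr
    split_ifs with h
    · have h2 := Real.log_nonpos (div_pos hv0 hε.1).le h.le
      rw [abs_of_nonpos h2, Real.log_div hv0.ne' hε.1.ne']
      linarith [neg_abs_le (Real.log v), Real.log_nonpos hε.1.le hε.2.le]
    · exact abs_nonneg _
  have hae (ε : ℝ) : AEStronglyMeasurable (fun v ↦ Real.exp (-v) *
      (∑ k ∈ Finset.Icc 0 ⌊Real.exp (v / ε)⌋₊, a k - Real.log (v / ε)))
      (volume.restrict (Ioi 0)) :=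
    ((by fun_prop : Measurable fun v : ℝ ↦ Real.exp (-v)).mul
      ((hmeas ε).sub (by fun_prop))).aestronglyMeasurable
  have hlim : Tendsto (fun ε : ℝ ↦ ∫ v in Ioi 0, Real.exp (-v) *
      (∑ k ∈ Finset.Icc 0 ⌊Real.exp (v / ε)⌋₊, a k - Real.log (v / ε))) (𝓝[>] 0)
      (𝓝 (∫ v in Ioi 0, Real.exp (-v) * C)) := by
    refine tendsto_integral_filter_of_dominated_convergence _ (Eventually.of_forall hae) ?_ hbd ?_
    · filter_upwards [Ioo_mem_nhdsGT one_pos] with ε hε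
      filter_upwards [ae_restrict_mem measurableSet_Ioi] with v hv using hle hε hv
    · filter_upwards [ae_restrict_mem measurableSet_Ioi] with v hv
      have h1 : Tendsto (fun ε : ℝ ↦ v / ε) (𝓝[>] 0) atTop := by
        simp_rw [div_eq_mul_inv]
        exact tendsto_inv_nhdsGT_zero.const_mul_atTop hv
      refine ((hC.comp (Real.tendsto_exp_atTop.comp h1)).congr fun ε ↦ ?_).const_mul _
      simp only [Function.comp_apply, Real.log_exp]
  rw [integral_mul_const, integral_exp_neg_Ioi_zero, one_mul] at hlim
  have h2 := hlim.add_const (-Real.eulerMascheroniConstant)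
  rw [← sub_eq_add_neg] at h2
  refine h2.congr' ?_
  filter_upwards [Ioo_mem_nhdsGT one_pos] with ε hε
  have h_int : IntegrableOn (fun v ↦ Real.exp (-v) *
      (∑ k ∈ Finset.Icc 0 ⌊Real.exp (v / ε)⌋₊, a k - Real.log (v / ε))) (Ioi 0) :=
    hbd.mono' (hae ε) (by
      filter_upwards [ae_restrict_mem measurableSet_Ioi] with v hv using hle hε hv)
  rw [tsum_mul_rpow_eq_integral h0 ha hC hε.1, ← integral_exp_neg_mul_log,
    ← integral_add h_int integrableOn_exp_neg_mul_log]
  have h3 : Real.log ε = ∫ v in Ioi 0, Real.exp (-v) * Real.log ε := by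
    rw [integral_mul_const, integral_exp_neg_Ioi_zero, one_mul]
  have h4 : ∫ v in Ioi 0, Real.exp (-v) * ∑ k ∈ Finset.Icc 0 ⌊Real.exp (v / ε)⌋₊, a k =
      ∫ v in Ioi 0, ((Real.exp (-v) *
      (∑ k ∈ Finset.Icc 0 ⌊Real.exp (v / ε)⌋₊, a k - Real.log (v / ε)) +
      Real.exp (-v) * Real.log v) - Real.exp (-v) * Real.log ε) := by
    refine setIntegral_congr_fun measurableSet_Ioi fun v hv ↦ ?_
    simp only [Real.log_div (mem_Ioi.mp hv).ne' hε.1.ne']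
    ring
  have h5 := integral_sub (h_int.add integrableOn_exp_neg_mul_log) (hexp.mul_const (Real.log ε))
  simp only [Pi.add_apply] at h5
  rw [h4, h5, ← h3, sub_add_cancel]

end LogLogSums

lemma rpow_neg_le_half {n : ℕ} (hn : 2 ≤ n) {s : ℝ} (hs : 1 ≤ s) :
    (n : ℝ) ^ (-s) ≤ (n : ℝ)⁻¹ ∧ (n : ℝ)⁻¹ ≤ 1 / 2 := by
  have hn' : (2 : ℝ) ≤ n := by exact_mod_cast hn
  constructor
  · rw [← Real.rpow_neg_one]
    exact Real.rpow_le_rpow_of_exponent_le (by linarith) (by linarith)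
  · rw [one_div]
    exact inv_anti₀ two_pos hn'

lemma neg_log_one_sub_mem {x : ℝ} (hx : x ≤ 1 / 2) :
    0 ≤ -Real.log (1 - x) - x ∧ -Real.log (1 - x) - x ≤ 2 * x ^ 2 := by
  have h1 := Real.log_le_sub_one_of_pos (x := 1 - x) (by linarith)
  have h2 := Real.one_sub_inv_le_log_of_pos (x := 1 - x) (by linarith)
  refine ⟨by linarith, ?_⟩
  have h3 : (1 - x)⁻¹ ≤ 1 + x + 2 * x ^ 2 := by
    rw [inv_le_iff_one_le_mul₀ (by linarith)]
    nlinarith [mul_nonneg (sq_nonneg x) (by linarith : 0 ≤ 1 - 2 * x)]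
  linarith

/-- The difference between the contributions of `n` to the logarithm of the Euler product of
`ζ(s)`, indexed by primes, and to the Dirichlet series of `log ζ(s)`. -/
noncomputable def eulerLogDiff (s : ℝ) (n : ℕ) : ℝ :=
  (if n.Prime then -Real.log (1 - (n : ℝ) ^ (-s)) else 0) -
    vonMangoldt n / ((n : ℝ) ^ s * Real.log n)

lemma eulerLogDiff_of_prime (s : ℝ) {p : ℕ} (hp : p.Prime) :
    eulerLogDiff s p = -Real.log (1 - (p : ℝ) ^ (-s)) - (p : ℝ) ^ (-s) := by
  have := Real.log_pos (x := p) (by exact_mod_cast hp.one_lt)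
  rw [eulerLogDiff, if_pos hp, vonMangoldt_apply_prime hp, Real.rpow_neg p.cast_nonneg]
  field

lemma eulerLogDiff_of_not_prime (s : ℝ) {n : ℕ} (hn : ¬ n.Prime) :
    eulerLogDiff s n = -(vonMangoldt n / ((n : ℝ) ^ s * Real.log n)) := by
  rw [eulerLogDiff, if_neg hn, zero_sub]

lemma abs_eulerLogDiff_le {s : ℝ} (hs : 1 ≤ s) (n : ℕ) :
    |eulerLogDiff s n| ≤ 2 * ((n : ℝ) ^ 2)⁻¹ +
      (Real.log 2)⁻¹ * ((if n.Prime then 0 else vonMangoldt n) / n) := by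
  have hlog2 : 0 < Real.log 2 := Real.log_pos one_lt_two
  by_cases hn : n.Prime
  · have h1 := rpow_neg_le_half hn.two_le hs
    have h0 : 0 ≤ (n : ℝ) ^ (-s) := by positivity
    have h2 := neg_log_one_sub_mem (h1.1.trans h1.2)
    rw [eulerLogDiff_of_prime s hn, if_pos hn, zero_div, mul_zero, add_zero, abs_of_nonneg h2.1,
      ← inv_pow]
    exact h2.2.trans (by gcongr; exact h1.1)
  · rw [eulerLogDiff_of_not_prime s hn, if_neg hn, abs_neg]
    rcases lt_or_ge n 2 with h | h
    · interval_cases n <;> simp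
    · have hn' : (2 : ℝ) ≤ n := by exact_mod_cast h
      have h1 : Real.log 2 ≤ Real.log n := Real.log_le_log two_pos hn'
      have h2 : (n : ℝ) ≤ (n : ℝ) ^ s := Real.self_le_rpow_of_one_le (by linarith) hs
      have h3 : (0 : ℝ) ≤ vonMangoldt n := vonMangoldt_nonneg
      rw [abs_of_nonneg (by positivity)]
      calc vonMangoldt n / ((n : ℝ) ^ s * Real.log n) ≤ vonMangoldt n / (n * Real.log 2) := by
            gcongr
        _ = (Real.log 2)⁻¹ * (vonMangoldt n / n) := by field
        _ ≤ _ := le_add_of_nonneg_left (by positivity)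

lemma summable_eulerLogDiff_bound : Summable fun n : ℕ ↦ 2 * ((n : ℝ) ^ 2)⁻¹ +
      (Real.log 2)⁻¹ * ((if n.Prime then 0 else vonMangoldt n) / n) := by
  refine ((Real.summable_nat_pow_inv.mpr one_lt_two).mul_left 2).add (Summable.mul_left _ ?_)
  have h (n : ℕ) : vonMangoldt.residueClass (1 : ZMod 1) n = vonMangoldt n :=
    indicator_of_mem (s := {n : ℕ | (n : ZMod 1) = 1}) (Subsingleton.elim _ _) _
  simpa only [h] using vonMangoldt.summable_residueClass_non_primes_div (1 : ZMod 1)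

lemma summable_eulerLogDiff {s : ℝ} (hs : 1 ≤ s) : Summable (eulerLogDiff s) :=
  .of_norm_bounded summable_eulerLogDiff_bound (abs_eulerLogDiff_le hs)

lemma tsum_eulerLogDiff_eq_zero {s : ℝ} (hs : 1 < s) : ∑' n, eulerLogDiff s n = 0 := by
  have hΛ : Summable fun n : ℕ ↦ vonMangoldt n / ((n : ℝ) ^ s * Real.log n) := by
    refine .of_nonneg_of_le (fun n ↦ ?_) (fun n ↦ ?_) (Real.summable_nat_rpow_inv.mpr hs)
    · have := Real.log_natCast_nonneg n
      have : 0 ≤ vonMangoldt n := vonMangoldt_nonneg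
      positivity
    · rw [mul_comm, ← div_div, div_eq_mul_inv _ ((n : ℝ) ^ s)]
      exact mul_le_of_le_one_left (by positivity)
        (div_le_one_of_le₀ vonMangoldt_le_log (Real.log_natCast_nonneg n))
  have hP : Summable fun n : ℕ ↦ if n.Prime then -Real.log (1 - (n : ℝ) ^ (-s)) else 0 :=
    ((summable_eulerLogDiff hs.le).add hΛ).congr fun n ↦ by rw [eulerLogDiff, sub_add_cancel]
  have h1 : ∑' n, eulerLogDiff s n = _ := hP.tsum_sub hΛ
  rw [h1, ← log_riemannZeta_eq hs, sub_eq_zero]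
  have h2 := riemannZeta_eulerProduct_exp_log (s := s) (by simpa using hs)
  have h3 : ∑' p : Nat.Primes, -Complex.log (1 - (p : ℂ) ^ (-(s : ℂ))) =
      ((∑' p : Nat.Primes, -Real.log (1 - (p : ℝ) ^ (-s)) : ℝ) : ℂ) := by
    rw [Complex.ofReal_tsum]
    congr 1 with p
    have h4 := rpow_neg_le_half p.2.two_le hs.le
    rw [Complex.ofReal_neg, Complex.ofReal_log (by linarith)]
    push_cast
    rw [Complex.ofReal_cpow (by positivity)]
    push_cast
    rfl
  rw [h3, ← Complex.ofReal_exp] at h2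
  rw [← h2, Complex.ofReal_re, Real.log_exp]
  refine Eq.trans ?_
    (tsum_subtype {n : ℕ | n.Prime} fun n ↦ -Real.log (1 - (n : ℝ) ^ (-s))).symm
  exact tsum_congr fun n ↦ by simp [indicator_apply]

lemma hasSum_eulerLogDiff_one : HasSum (eulerLogDiff 1) 0 := by
  have h : Tendsto (fun s : ℝ ↦ ∑' n, eulerLogDiff s n) (𝓝[>] 1) (𝓝 (∑' n, eulerLogDiff 1 n)) := by
    refine tendsto_tsum_of_dominated_convergence summable_eulerLogDiff_bound (fun n ↦ ?_) ?_
    · refine tendsto_nhdsWithin_of_tendsto_nhds (ContinuousAt.tendsto ?_)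
      rcases Nat.eq_zero_or_pos n with rfl | hn0
      · have : (fun s ↦ eulerLogDiff s 0) = fun _ ↦ 0 := funext fun s ↦ by
          simp [eulerLogDiff_of_not_prime s Nat.not_prime_zero]
        rw [this]
        exact continuousAt_const
      have hn : (n : ℝ) ≠ 0 := by positivity
      by_cases hp : n.Prime
      · simp only [eulerLogDiff_of_prime _ hp]
        have h4 := rpow_neg_le_half hp.two_le le_rfl
        have h5 : 1 - (n : ℝ) ^ (-1 : ℝ) ≠ 0 := by linarith
        have h6 : ContinuousAt (fun s : ℝ ↦ (n : ℝ) ^ (-s)) 1 :=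
          (Real.continuousAt_const_rpow hn).comp continuousAt_neg
        exact ((continuousAt_const.sub h6).log h5).neg.sub h6
      · simp only [eulerLogDiff_of_not_prime _ hp]
        have h6 : ContinuousAt (fun s : ℝ ↦ ((n : ℝ) ^ s)⁻¹) 1 :=
          (Real.continuousAt_const_rpow hn).inv₀ (by positivity)
        refine ContinuousAt.neg ?_
        simp_rw [div_eq_mul_inv, mul_inv]
        exact continuousAt_const.mul (h6.mul continuousAt_const)
    · filter_upwards [self_mem_nhdsWithin] with s hs n
      exact abs_eulerLogDiff_le (mem_Ioi.mp hs).le n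
  have h2 : Tendsto (fun s : ℝ ↦ ∑' n, eulerLogDiff s n) (𝓝[>] 1) (𝓝 0) := by
    refine tendsto_const_nhds.congr' ?_
    filter_upwards [self_mem_nhdsWithin] with s hs using (tsum_eulerLogDiff_eq_zero hs).symm
  rw [← tendsto_nhds_unique h h2]
  exact (summable_eulerLogDiff le_rfl).hasSum

lemma tendsto_log_riemannZeta_add_log :
    Tendsto (fun ε : ℝ ↦ Real.log (riemannZeta (1 + ε : ℝ)).re + Real.log ε) (𝓝[>] 0) (𝓝 0) := by
  have h1 : Tendsto (fun ε : ℝ ↦ ((1 + ε : ℝ) : ℂ)) (𝓝[>] 0) (𝓝[≠] 1) := by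
    refine tendsto_nhdsWithin_iff.mpr ⟨?_, ?_⟩
    · have : Continuous fun ε : ℝ ↦ ((1 + ε : ℝ) : ℂ) := by fun_prop
      exact tendsto_nhdsWithin_of_tendsto_nhds (by simpa using this.tendsto 0)
    · filter_upwards [self_mem_nhdsWithin] with ε hε
      have : ε ≠ 0 := (mem_Ioi.mp hε).ne'
      simpa using this
  have h2 := (Complex.continuous_re.tendsto _).comp (riemannZeta_residue_one.comp h1)
  have h3 : Tendsto (fun ε : ℝ ↦ ε * (riemannZeta (1 + ε : ℝ)).re) (𝓝[>] 0) (𝓝 1) := by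
    simpa [Function.comp_def] using h2
  have h4 := (Real.continuousAt_log one_ne_zero).tendsto.comp h3
  rw [Real.log_one] at h4
  refine h4.congr' ?_
  filter_upwards [self_mem_nhdsWithin, h3.eventually_ne one_ne_zero] with ε hε hne
  rw [Function.comp_apply, Real.log_mul (left_ne_zero_of_mul hne) (right_ne_zero_of_mul hne),
    add_comm]

theorem tendsto_sum_vonMangoldt_div_mul_log_sub_log_log :
    Tendsto (fun b : ℝ ↦ ∑ k ∈ Finset.Icc 0 ⌊b⌋₊, vonMangoldt k / (k * Real.log k) -
      Real.log (Real.log b)) atTop (𝓝 Real.eulerMascheroniConstant) := by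
  obtain ⟨C, hC⟩ := exists_tendsto_sum_vonMangoldt_div_mul_log_sub_log_log
  have hnonneg (n : ℕ) : 0 ≤ vonMangoldt n / (n * Real.log n) := by
    have := Real.log_natCast_nonneg n
    have : 0 ≤ vonMangoldt n := vonMangoldt_nonneg
    positivity
  have h1 := tendsto_tsum_mul_rpow_add_log (by simp) hnonneg hC
  have h2 : Tendsto (fun ε : ℝ ↦ ∑' n : ℕ, vonMangoldt n / (n * Real.log n) * (n : ℝ) ^ (-ε) +
      Real.log ε) (𝓝[>] 0) (𝓝 0) := by
    refine tendsto_log_riemannZeta_add_log.congr' ?_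
    filter_upwards [self_mem_nhdsWithin] with ε hε
    rw [log_riemannZeta_eq (by linarith [mem_Ioi.mp hε])]
    congr 2 with n
    rcases Nat.eq_zero_or_pos n with rfl | hn
    · simp
    · have hn0 : (0 : ℝ) < n := by exact_mod_cast hn
      rw [Real.rpow_add hn0, Real.rpow_one, Real.rpow_neg hn0.le]
      field
  rwa [sub_eq_zero.mp (tendsto_nhds_unique h1 h2)] at hC

/-- **Mertens' third theorem**. -/
theorem tendsto_prod_one_sub_inv_mul_log :
    Tendsto (fun b : ℝ ↦ (∏ p ∈ Finset.range (⌊b⌋₊ + 1) with p.Prime, (1 - 1 / (p : ℝ))) *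
      Real.log b) atTop (𝓝 (Real.exp (-Real.eulerMascheroniConstant))) := by
  have h1 := (hasSum_eulerLogDiff_one.tendsto_sum_nat.comp (tendsto_add_atTop_nat 1)).comp
    (tendsto_nat_floor_atTop (α := ℝ))
  have h2 := (h1.add tendsto_sum_vonMangoldt_div_mul_log_sub_log_log).neg.rexp
  rw [zero_add] at h2
  refine h2.congr' ?_
  filter_upwards [eventually_gt_atTop 1] with b hb
  have hIcc : Finset.Icc 0 ⌊b⌋₊ = Finset.range (⌊b⌋₊ + 1) := by
    ext
    simp
  have h3 : ∑ k ∈ Finset.range (⌊b⌋₊ + 1), eulerLogDiff 1 k +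
      ∑ k ∈ Finset.range (⌊b⌋₊ + 1), vonMangoldt k / (k * Real.log k) =
      -∑ p ∈ Finset.range (⌊b⌋₊ + 1) with p.Prime, Real.log (1 - 1 / (p : ℝ)) := by
    rw [← Finset.sum_add_distrib, ← Finset.sum_neg_distrib, Finset.sum_filter]
    refine Finset.sum_congr rfl fun k _ ↦ ?_
    rw [eulerLogDiff, Real.rpow_one, Real.rpow_neg_one, one_div, sub_add_cancel]
  have h4 : ∀ p ∈ Finset.filter Nat.Prime (Finset.range (⌊b⌋₊ + 1)), 0 < 1 - 1 / (p : ℝ) := by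
    intro p hp
    have h5 := rpow_neg_le_half (Finset.mem_filter.mp hp).2.two_le le_rfl
    rw [one_div]
    linarith
  simp only [Function.comp_apply, hIcc]
  rw [← add_sub_assoc, h3, neg_sub, sub_neg_eq_add, Real.exp_add,
    Real.exp_log (Real.log_pos hb), Real.exp_sum, mul_comm]
  congr 1
  exact Finset.prod_congr rfl fun p hp ↦ Real.exp_log (h4 p hp)

lemma prod_filter_prime_range_nth (n : ℕ) :
    ∏ p ∈ Finset.range (Nat.nth Nat.Prime n + 1) with p.Prime, (1 - 1 / (p : ℝ)) =
      ∏ j ∈ Finset.Icc 1 (n + 1), (1 - 1 / (Nat.nth Nat.Prime (j - 1) : ℝ)) := by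
  have h (k : ℕ) : ∏ p ∈ Finset.range (Nat.nth Nat.Prime k) with p.Prime, (1 - 1 / (p : ℝ)) =
      ∏ j ∈ Finset.Icc 1 k, (1 - 1 / (Nat.nth Nat.Prime (j - 1) : ℝ)) := by
    induction k with
    | zero =>
      rw [Nat.nth_prime_zero_eq_two]
      exact Finset.prod_eq_one fun p hp ↦ absurd (Finset.mem_range.mp (Finset.mem_filter.mp hp).1)
        (Finset.mem_filter.mp hp).2.two_le.not_gt
    | succ k ih =>
      rw [Nat.filter_range_nth_eq_insert_of_infinite Nat.infinite_setOfPred_prime,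
        Finset.prod_insert (by simp), ih, Finset.prod_Icc_succ_top (by lia), mul_comm,
        Nat.add_sub_cancel]
  rw [Finset.range_add_one, Finset.filter_insert, if_pos (Nat.prime_nth_prime n),
    Finset.prod_insert (by simp), h, Finset.prod_Icc_succ_top (by lia), mul_comm,
    Nat.add_sub_cancel]

lemma sum_primeGap_mul_prod (n : ℕ) :
    ∑ i ∈ Finset.Icc 1 n, ((Nat.nth Nat.Prime i : ℝ) - (Nat.nth Nat.Prime (i - 1) : ℝ)) *
        ∏ j ∈ Finset.Icc 1 i, (1 - 1 / (Nat.nth Nat.Prime (j - 1) : ℝ)) =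
      Nat.nth Nat.Prime n * ∏ j ∈ Finset.Icc 1 (n + 1), (1 - 1 / (Nat.nth Nat.Prime (j - 1) : ℝ)) +
        (∏ j ∈ Finset.Icc 1 n, (1 - 1 / (Nat.nth Nat.Prime (j - 1) : ℝ)) - 2) +
        ∑ i ∈ Finset.range n, ∏ j ∈ Finset.Icc 1 i, (1 - 1 / (Nat.nth Nat.Prime (j - 1) : ℝ)) := by
  have hq (k : ℕ) : (Nat.nth Nat.Prime k : ℝ) ≠ 0 :=
    Nat.cast_ne_zero.mpr (Nat.prime_nth_prime k).ne_zero
  induction n with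
  | zero => simp; norm_num
  | succ n ih =>
    rw [Finset.sum_Icc_succ_top (by lia), ih, Finset.sum_range_succ,
      Finset.prod_Icc_succ_top (by lia : 1 ≤ n + 1 + 1),
      Finset.prod_Icc_succ_top (by lia : 1 ≤ n + 1)]
    simp only [Nat.add_sub_cancel]
    have h1 := hq n
    have h2 := hq (n + 1)
    field_simp
    ring

lemma tendsto_nth_prime_atTop : Tendsto (fun n ↦ (Nat.nth Nat.Prime n : ℝ)) atTop atTop :=
  tendsto_natCast_atTop_atTop.comp (Nat.nth_strictMono Nat.infinite_setOfPred_prime).tendsto_atTop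

lemma tendsto_prod_nth_prime_mul_log :
    Tendsto (fun n ↦ (∏ j ∈ Finset.Icc 1 (n + 1), (1 - 1 / (Nat.nth Nat.Prime (j - 1) : ℝ))) *
      Real.log (Nat.nth Nat.Prime n)) atTop (𝓝 (Real.exp (-Real.eulerMascheroniConstant))) := by
  refine (tendsto_prod_one_sub_inv_mul_log.comp tendsto_nth_prime_atTop).congr fun n ↦ ?_
  rw [Function.comp_apply, Nat.floor_natCast, prod_filter_prime_range_nth]

lemma tendsto_prod_nth_prime :
    Tendsto (fun n ↦ ∏ j ∈ Finset.Icc 1 n, (1 - 1 / (Nat.nth Nat.Prime (j - 1) : ℝ)))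
      atTop (𝓝 0) := by
  rw [← tendsto_add_atTop_iff_nat 1]
  refine (tendsto_prod_nth_prime_mul_log.div_atTop
    (Real.tendsto_log_atTop.comp tendsto_nth_prime_atTop)).congr fun n ↦ ?_
  have : Real.log (Nat.nth Nat.Prime n) ≠ 0 :=
    (Real.log_pos (by exact_mod_cast (Nat.prime_nth_prime n).one_lt)).ne'
  exact mul_div_cancel_right₀ _ this

lemma tendsto_succ_mul_log_nth_prime_div :
    Tendsto (fun n : ℕ ↦ (n + 1) * Real.log (Nat.nth Nat.Prime n) / Nat.nth Nat.Prime n)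
      atTop (𝓝 1) := by
  refine (tendsto_primeCounting_mul_log_div_id.comp tendsto_nth_prime_atTop).congr fun n ↦ ?_
  have : Nat.primeCounting (Nat.nth Nat.Prime n) = n + 1 := by
    rw [Nat.primeCounting, Nat.primeCounting', Nat.count_succ, if_pos (Nat.prime_nth_prime n)]
    exact congrArg (· + 1) (Nat.primeCounting'_nth_eq n)
  rw [Function.comp_apply, Nat.floor_natCast, this]
  push_cast
  rfl

lemma tendsto_nth_prime_mul_prod_div :
    Tendsto (fun n : ℕ ↦ (n : ℝ)⁻¹ * (Nat.nth Nat.Prime n *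
      ∏ j ∈ Finset.Icc 1 (n + 1), (1 - 1 / (Nat.nth Nat.Prime (j - 1) : ℝ))))
      atTop (𝓝 (Real.exp (-Real.eulerMascheroniConstant))) := by
  have h1 : Tendsto (fun n : ℕ ↦ 1 + (n : ℝ)⁻¹) atTop (𝓝 (1 + 0)) :=
    tendsto_const_nhds.add tendsto_inv_atTop_nhds_zero_nat
  have h2 := (tendsto_prod_nth_prime_mul_log.div tendsto_succ_mul_log_nth_prime_div
    one_ne_zero).mul h1
  rw [div_one, add_zero, mul_one] at h2
  refine h2.congr' ?_
  filter_upwards [eventually_gt_atTop 0] with n hn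
  have hn' : (n : ℝ) ≠ 0 := by positivity
  have hq : (Nat.nth Nat.Prime n : ℝ) ≠ 0 := Nat.cast_ne_zero.mpr (Nat.prime_nth_prime n).ne_zero
  have hlog : Real.log (Nat.nth Nat.Prime n) ≠ 0 :=
    (Real.log_pos (by exact_mod_cast (Nat.prime_nth_prime n).one_lt)).ne'
  simp only [Pi.div_apply]
  field

end

/-- For the real primes, the average of the normalized prime gaps
`(p (i+1) - p i) * d i`, with `d i = ∏_{j=1}^{i} (1 - 1/(p j))`, falls short of `1` by
`1 - e^{-γ}`:  `(1/n) ∑_{i=1}^{n} ((p (i+1) - p i) * d i - 1) → e^{-γ} - 1`. -/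
theorem average_normalized_prime_gap :
    Filter.Tendsto
      (fun n : ℕ => (1 / (n : ℝ)) * ∑ i ∈ Finset.Icc 1 n,
        (((Nat.nth Nat.Prime i : ℝ) - (Nat.nth Nat.Prime (i - 1) : ℝ)) *
            (∏ j ∈ Finset.Icc 1 i, (1 - 1 / (Nat.nth Nat.Prime (j - 1) : ℝ))) - 1))
      Filter.atTop (nhds (Real.exp (-Real.eulerMascheroniConstant) - 1)) := by
  have h1 := tendsto_inv_atTop_nhds_zero_nat (𝕜 := ℝ) |>.mul (tendsto_prod_nth_prime.sub_const 2)
  have h2 := ((tendsto_nth_prime_mul_prod_div.add h1).add tendsto_prod_nth_prime.cesaro).sub_const 1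
  rw [zero_mul, add_zero, add_zero] at h2
  refine h2.congr' ?_
  filter_upwards [Filter.eventually_gt_atTop 0] with n hn
  have hn' : (n : ℝ) ≠ 0 := by positivity
  rw [Finset.sum_sub_distrib, sum_primeGap_mul_prod, Finset.sum_const, Nat.card_Icc,
    Nat.add_sub_cancel, nsmul_one, one_div, mul_sub _ _ (n : ℝ), inv_mul_cancel₀ hn', mul_add, mul_add]
end
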